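/- Let P ⊆ ℝ^d be a d-dimensional polytope and let Σ ⊆ ℝ^d be any d-simplex. Then for every p ∈ int P and every q ∈ int Σ, the asymptotic volumes satisfy liminf_{R→∞} Vol^B_{int P}(B_{int P}(p,R))/R^d = (|Flags(P)|/(d+1)!) · liminf_{R→∞} Vol^B_{int Σ}(B_{int Σ}(q,R))/R^d. -/

import Mathlib

open Filter Set MeasureTheory Metric
open scoped ENNReal Topology Pointwise RealInnerProductSpace

noncomputable section
open scoped Classical

abbrev Euc (d : ℕ) := EuclideanSpace ℝ (Fin d)

/-- The Hilbert distance on a bounded open convex set `U`. -/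
def hilbertDist {d : ℕ} (U : Set (Euc d)) (p q : Euc d) : ℝ :=
  if p = q then 0
  else
    (1 / 2) * Real.log
      (((1 - sInf {t : ℝ | p + t • (q - p) ∈ U}) / (- sInf {t : ℝ | p + t • (q - p) ∈ U})) *
        (sSup {t : ℝ | p + t • (q - p) ∈ U} / (sSup {t : ℝ | p + t • (q - p) ∈ U} - 1)))

/-- The closed Hilbert ball. -/
def hilbertBall {d : ℕ} (U : Set (Euc d)) (p : Euc d) (R : ℝ) : Set (Euc d) :=
  {q ∈ U | hilbertDist U p q ≤ R}

/-- The Finsler (Hilbert) norm `F_U(p, v)`. -/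
def finslerNorm {d : ℕ} (U : Set (Euc d)) (p v : Euc d) : ℝ :=
  if v = 0 then 0
  else (1 / 2) * (1 / sSup {t : ℝ | 0 < t ∧ p + t • v ∈ U}
                + 1 / sSup {t : ℝ | 0 < t ∧ p - t • v ∈ U})

/-- The unit ball `β_U(p)` of the Finsler norm. -/
def finslerUnitBall {d : ℕ} (U : Set (Euc d)) (p : Euc d) : Set (Euc d) :=
  {v | finslerNorm U p v < 1}

/-- The Busemann volume of `A ⊆ U`. -/
def busemannVol {d : ℕ} (U : Set (Euc d)) (A : Set (Euc d)) : ℝ≥0∞ :=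
  ∫⁻ p in A, volume (Metric.ball (0 : Euc d) 1) / volume (finslerUnitBall U p)

/-- The polar body `K°`. -/
def polarSet {d : ℕ} (K : Set (Euc d)) : Set (Euc d) :=
  {y | ∀ v ∈ K, ⟪v, y⟫ ≤ (1 : ℝ)}

/-- The Holmes–Thompson volume of `A ⊆ U`. -/
def htVol {d : ℕ} (U : Set (Euc d)) (A : Set (Euc d)) : ℝ≥0∞ :=
  ∫⁻ p in A, volume (polarSet (finslerUnitBall U p)) / volume (Metric.ball (0 : Euc d) 1)

/-- The asymptotic ball `AsB_U(y, R)`. -/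
def asympBall {d : ℕ} (U : Set (Euc d)) (y : Euc d) (R : ℝ) : Set (Euc d) :=
  if 0 < R then (fun u => y + (1 - Real.exp (-2 * R)) • (u - y)) '' U else ∅

/-- `F` is a face of the compact convex set `P`. -/
def IsFace {d : ℕ} (P F : Set (Euc d)) : Prop :=
  F.Nonempty ∧ IsClosed F ∧ Convex ℝ F ∧ IsExtreme ℝ P F

/-- The dimension of a set: the dimension of its affine span. -/
def faceDim {d : ℕ} (F : Set (Euc d)) : ℕ :=
  Module.finrank ℝ (affineSpan ℝ F).direction

/-- The set of maximal flags of a `dm`-dimensional polytope `P ⊆ ℝ^d`. -/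
def flagSet {d : ℕ} (dm : ℕ) (P : Set (Euc d)) : Set (Fin (dm + 1) → Set (Euc d)) :=
  {f | (∀ i, IsFace P (f i) ∧ faceDim (f i) = (i : ℕ)) ∧
       ∀ i j : Fin (dm + 1), i ≤ j → f i ⊆ f j}

/-- `N(ε, Ω)`: the least number of maximal flags of a `d`-dimensional polytope within
Hausdorff distance `ε` of `Ω`. -/
def flagNumber (d : ℕ) (Ω : Set (Euc d)) (ε : ℝ) : ℕ :=
  sInf {n | ∃ V : Finset (Euc d), V.Nonempty ∧
    faceDim (convexHull ℝ (V : Set (Euc d))) = d ∧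
    Metric.hausdorffDist (convexHull ℝ (V : Set (Euc d))) Ω ≤ ε ∧
    (flagSet d (convexHull ℝ (V : Set (Euc d)))).ncard = n}

/-- The flag approximability `a_f(Ω)`. -/
def flagApprox (d : ℕ) (Ω : Set (Euc d)) : ℝ :=
  liminf (fun ε : ℝ => Real.log (flagNumber d Ω ε) / (- Real.log ε)) (𝓝[>] 0)

/-- `s` is a `dm`-simplex. -/
def IsSimplexSet {d : ℕ} (dm : ℕ) (s : Set (Euc d)) : Prop :=
  ∃ v : Fin (dm + 1) → Euc d, AffineIndependent ℝ v ∧ s = convexHull ℝ (Set.range v)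

/-- `S` is a flag simplex of the `dm`-dimensional polytope `P`. -/
def IsFlagSimplex {d : ℕ} (dm : ℕ) (P S : Set (Euc d)) : Prop :=
  ∃ f ∈ flagSet dm P, ∃ v : Fin (dm + 1) → Euc d, AffineIndependent ℝ v ∧
    S = convexHull ℝ (Set.range v) ∧ ∀ i, v i ∈ intrinsicInterior ℝ (f i)

/-- The Macbeath region `M'(x)`. -/
def macbeath {d : ℕ} (Ω : Set (Euc d)) (x : Euc d) : Set (Euc d) :=
  (fun v => x + v) ''
    (((5 : ℝ)⁻¹ • ((fun w => w - x) '' Ω)) ∩ ((5 : ℝ)⁻¹ • ((fun w => x - w) '' Ω)))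

/-- The Funk distance with respect to the convex body `Ω`. -/
def funkDist {d : ℕ} (Ω : Set (Euc d)) (p q : Euc d) : ℝ :=
  if p = q then 0
  else Real.log (sSup {t : ℝ | p + t • (q - p) ∈ Ω} /
        (sSup {t : ℝ | p + t • (q - p) ∈ Ω} - 1))

/-! ### Finite cones are intersections of finitely many half-spaces -/

/-- Fourier-Motzkin elimination: finitely generated cones are finitely constrained. -/
theorem fg_cone_hrep {W α : Type*} [AddCommGroup W] [Module ℝ W] [FiniteDimensional ℝ W]
    (f : α → W) (T : Finset α) :
    ∃ S : Set (W →ₗ[ℝ] ℝ), S.Finite ∧ ∀ x : W,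
      (∃ c : α → ℝ, (∀ a, 0 ≤ c a) ∧ x = ∑ a ∈ T, c a • f a) ↔ ∀ L ∈ S, 0 ≤ L x := by
  induction T using Finset.induction_on with
  | empty =>
    let bs := Module.finBasis ℝ W
    refine ⟨Set.range (fun i => bs.coord i) ∪ Set.range (fun i => -bs.coord i),
      (Set.finite_range _).union (Set.finite_range _), fun x => ?_⟩
    constructor
    · rintro ⟨c, -, rfl⟩ L -
      simp
    · intro h
      refine ⟨fun _ => 0, fun _ => le_rfl, ?_⟩
      simp only [Finset.sum_empty]
      apply bs.ext_elem
      intro i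
      have h1 := h (bs.coord i) (Or.inl ⟨i, rfl⟩)
      have h2 := h (-bs.coord i) (Or.inr ⟨i, rfl⟩)
      simp only [LinearMap.neg_apply, Module.Basis.coord_apply] at h1 h2
      simp only [map_zero, Finsupp.coe_zero, Pi.zero_apply]
      linarith
  | insert a T ha ih =>
    obtain ⟨S, hS, hSx⟩ := ih
    set v := f a with hv
    refine ⟨{L ∈ S | 0 ≤ L v} ∪ Set.image2 (fun L M => L v • M - M v • L) {L ∈ S | 0 < L v}
      {M ∈ S | M v < 0}, (hS.subset (Set.sep_subset _ _)).union
        (Set.Finite.image2 _ (hS.subset (Set.sep_subset _ _)) (hS.subset (Set.sep_subset _ _))),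
        fun x => ?_⟩
    have key : (∃ c : α → ℝ, (∀ b, 0 ≤ c b) ∧ x = ∑ b ∈ insert a T, c b • f b) ↔
        ∃ t : ℝ, 0 ≤ t ∧ ∀ L ∈ S, 0 ≤ L (x - t • v) := by
      constructor
      · rintro ⟨c, hc, hx⟩
        refine ⟨c a, hc a, (hSx _).1 ⟨c, hc, ?_⟩⟩
        rw [hx, Finset.sum_insert ha]; simp [hv]
      · rintro ⟨t, ht, h⟩
        obtain ⟨c, hc, hx⟩ := (hSx _).2 h
        refine ⟨Function.update c a t, fun b => ?_, ?_⟩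
        · by_cases hb : b = a
          · subst hb; simpa using ht
          · simpa [hb] using hc b
        · rw [Finset.sum_insert ha]
          have : ∑ b ∈ T, Function.update c a t b • f b = ∑ b ∈ T, c b • f b := by
            apply Finset.sum_congr rfl
            intro b hb
            have : b ≠ a := fun h => ha (h ▸ hb)
            simp [this]
          rw [this, ← hx]; simp [hv]
    rw [key]
    constructor
    · rintro ⟨t, ht, h⟩ L (⟨hL, hLv⟩ | ⟨L, ⟨hL, hLv⟩, M, ⟨hM, hMv⟩, rfl⟩)
      · have := h L hL
        simp only [map_sub, map_smul, smul_eq_mul] at this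
        nlinarith [mul_nonneg ht hLv]
      · have h1 := h L hL
        have h2 := h M hM
        simp only [map_sub, map_smul, smul_eq_mul] at h1 h2
        simp only [LinearMap.sub_apply, LinearMap.smul_apply, smul_eq_mul]
        nlinarith [mul_nonneg hLv.le h2, mul_nonneg (neg_pos.2 hMv).le h1]
    · intro h
      -- choose t as the max of 0 and the lower bounds
      let N : Set (W →ₗ[ℝ] ℝ) := {M ∈ S | M v < 0}
      have hN : N.Finite := hS.subset (Set.sep_subset _ _)
      let Tt : Finset ℝ := insert 0 (hN.toFinset.image (fun M => M x / M v))
      have hTt : Tt.Nonempty := ⟨0, by simp [Tt]⟩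
      refine ⟨Tt.max' hTt, Finset.le_max' _ _ (by simp [Tt]), fun L hL => ?_⟩
      simp only [map_sub, map_smul, smul_eq_mul]
      rcases lt_trichotomy (L v) 0 with hLv | hLv | hLv
      · have : L x / L v ≤ Tt.max' hTt := by
          apply Finset.le_max'
          simp only [Tt, Finset.mem_insert, Finset.mem_image, Set.Finite.mem_toFinset]
          exact Or.inr ⟨L, ⟨hL, hLv⟩, rfl⟩
        rw [div_le_iff_of_neg hLv] at this
        linarith
      · have := h L (Or.inl ⟨hL, hLv.ge⟩)
        rw [hLv]; simpa using this
      · have hm := Finset.max'_mem Tt hTt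
        have h0 := h L (Or.inl ⟨hL, hLv.le⟩)
        suffices Tt.max' hTt ≤ L x / L v by
          rw [le_div_iff₀ hLv] at this; linarith
        simp only [Tt, Finset.mem_insert, Finset.mem_image, Set.Finite.mem_toFinset] at hm
        rcases hm with hm | ⟨M, ⟨hM, hMv⟩, hm⟩
        · simp only [Tt]; rw [hm]; positivity
        · simp only [Tt]; rw [← hm]
          have h3 := h (L v • M - M v • L) (Or.inr ⟨L, ⟨hL, hLv⟩, M, ⟨hM, hMv⟩, rfl⟩)
          simp only [LinearMap.sub_apply, LinearMap.smul_apply, smul_eq_mul] at h3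
          rw [div_le_iff_of_neg hMv, div_mul_eq_mul_div, div_le_iff₀ hLv]
          nlinarith

/-- A half-space representation of a full-dimensional polytope. -/
structure HRep {d : ℕ} (ι : Type) (P : Set (Euc d)) where
  g : ι → Euc d →L[ℝ] ℝ
  b : ι → ℝ
  mem : ∀ x, x ∈ P ↔ ∀ j, 0 ≤ g j x + b j
  int : ∀ x, x ∈ interior P ↔ ∀ j, 0 < g j x + b j
  bdd : Bornology.IsBounded P

/-- If the interior of a finite half-space intersection is nonempty, then it is described by the
strict inequalities. -/
theorem hrep_interior {d : ℕ} {ι : Type} [Finite ι] {P : Set (Euc d)} (g : ι → Euc d →L[ℝ] ℝ)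
    (b : ι → ℝ) (mem : ∀ x, x ∈ P ↔ ∀ j, 0 ≤ g j x + b j)
    (hne : ∀ j, g j ≠ 0 ∨ b j ≠ 0) (x : Euc d) : x ∈ interior P ↔ ∀ j, 0 < g j x + b j := by
  constructor
  · intro hx j
    have hx0 := (mem x).1 (interior_subset hx) j
    refine lt_of_le_of_ne hx0 (fun h0 => ?_)
    have hg : g j = 0 := by
      ext v
      have hnear : ∀ᶠ t in 𝓝 (0 : ℝ), x + t • v ∈ P := by
        have hc : ContinuousAt (fun t : ℝ => x + t • v) 0 := by fun_prop
        have := hc.preimage_mem_nhds (t := P) (by simpa using mem_interior_iff_mem_nhds.1 hx)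
        exact this
      obtain ⟨ε, hε, hb⟩ := Metric.eventually_nhds_iff.1 hnear
      have h1 := (mem _).1 (hb (y := ε / 2) (by simp [abs_of_pos hε, hε])) j
      have h2 := (mem _).1 (hb (y := -(ε / 2)) (by simp [abs_of_pos hε, hε])) j
      simp only [map_add, map_smul, smul_eq_mul] at h1 h2
      have h3 : 0 ≤ ε / 2 * g j v := by linarith
      have h4 : 0 ≤ -(ε / 2) * g j v := by linarith
      have h5 : ε / 2 * g j v = 0 := by linarith
      simpa [hε.ne'] using h5
    rcases hne j with h | h
    · exact h hg
    · rw [hg] at h0; simp at h0; exact h h0.symm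
  · intro hx
    have hopen : IsOpen {y : Euc d | ∀ j, 0 < g j y + b j} := by
      rw [show {y : Euc d | ∀ j, 0 < g j y + b j} = ⋂ j, {y | 0 < g j y + b j} by ext; simp]
      exact isOpen_iInter_of_finite fun j => isOpen_lt continuous_const (by fun_prop)
    exact (interior_maximal (fun y hy => (mem y).2 fun j => (hy j).le) hopen) hx

theorem exists_hrep {d : ℕ} (V : Finset (Euc d)) :
    ∃ (ι : Type) (_ : Fintype ι), Nonempty (HRep ι (convexHull ℝ (V : Set (Euc d)))) := by
  obtain ⟨S, hS, hSx⟩ := fg_cone_hrep (fun v : Euc d => ((v, 1) : Euc d × ℝ)) V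
  let S' : Set (Euc d × ℝ →ₗ[ℝ] ℝ) := S \ {0}
  have hS' : S'.Finite := hS.diff
  let g : S' → Euc d →L[ℝ] ℝ := fun L =>
    LinearMap.toContinuousLinearMap (L.1 ∘ₗ LinearMap.inl ℝ (Euc d) ℝ)
  let b : S' → ℝ := fun L => L.1 (0, 1)
  have hgb : ∀ (L : S') (x : Euc d), g L x + b L = L.1 (x, 1) := by
    intro L x
    simp only [g, b, LinearMap.coe_toContinuousLinearMap', LinearMap.comp_apply,
      LinearMap.inl_apply]
    rw [← map_add]; simp
  have mem : ∀ x, x ∈ convexHull ℝ (V : Set (Euc d)) ↔ ∀ j, 0 ≤ g j x + b j := by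
    intro x
    have h1 : (∀ j, 0 ≤ g j x + b j) ↔ ∀ L ∈ S, 0 ≤ L (x, 1) := by
      constructor
      · intro h L hL
        by_cases h0 : L = 0
        · simp [h0]
        · rw [← hgb ⟨L, hL, h0⟩]; exact h _
      · intro h L
        rw [hgb]; exact h _ L.2.1
    rw [h1, ← hSx, Finset.convexHull_eq]
    constructor
    · rintro ⟨w, hw, hw1, rfl⟩
      refine ⟨fun v => if v ∈ V then w v else 0, fun v => ?_, ?_⟩
      · dsimp only; split_ifs with h
        · exact hw v h
        · exact le_rfl
      · rw [Finset.centerMass_eq_of_sum_1 _ _ hw1]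
        have : ∑ a ∈ V, (if a ∈ V then w a else 0) • ((a, 1) : Euc d × ℝ) =
          ∑ a ∈ V, w a • ((a, 1) : Euc d × ℝ) :=
          Finset.sum_congr rfl fun a ha => by simp [ha]
        rw [this]
        ext
        · simp [Prod.fst_sum]
        · simp [Prod.snd_sum, hw1]
    · rintro ⟨c, hc, hx⟩
      have e1 := congrArg Prod.fst hx
      have e2 := congrArg Prod.snd hx
      simp only [Prod.fst_sum, Prod.snd_sum, Prod.smul_fst, Prod.smul_snd, smul_eq_mul,
        mul_one] at e1 e2
      refine ⟨c, fun v _ => hc v, e2.symm, ?_⟩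
      rw [Finset.centerMass_eq_of_sum_1 _ _ e2.symm, e1]; rfl
  haveI : Finite S' := hS'
  refine ⟨S', Fintype.ofFinite _, ⟨⟨g, b, mem, hrep_interior g b mem ?_, ?_⟩⟩⟩
  · intro L
    by_contra hcon
    push Not at hcon
    apply L.2.2
    simp only [Set.mem_singleton_iff]
    apply LinearMap.ext
    intro x
    have : L.1 x = g L x.1 + x.2 * b L := by
      simp only [g, b, LinearMap.coe_toContinuousLinearMap', LinearMap.comp_apply,
        LinearMap.inl_apply]
      rw [← smul_eq_mul, ← map_smul, ← map_add]; simp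
    rw [this, hcon.1, hcon.2]; simp
  · exact (isBounded_convexHull).2 V.finite_toSet.isBounded

/-! ### Faces, chains and the barycentric decomposition -/

namespace HRep

set_option linter.unusedSectionVars false
variable {d : ℕ} {ι : Type} {P : Set (Euc d)}

/-- The affine functional of the `j`-th half-space. -/
def l (H : HRep ι P) (j : ι) (x : Euc d) : ℝ := H.g j x + H.b j

theorem l_add_smul (H : HRep ι P) (j : ι) (x v : Euc d) (t : ℝ) :
    H.l j (x + t • v) = H.l j x + t * H.g j v := by
  simp only [l, map_add, map_smul, smul_eq_mul]; ring

theorem l_comb (H : HRep ι P) (j : ι) (x y : Euc d) (s t : ℝ) (h : s + t = 1) :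
    H.l j (s • x + t • y) = s * H.l j x + t * H.l j y := by
  have : H.b j = (s + t) * H.b j := by rw [h, one_mul]
  simp only [l, map_add, map_smul, smul_eq_mul]; linear_combination this

theorem g_sub (H : HRep ι P) (j : ι) (x y : Euc d) : H.g j (x - y) = H.l j x - H.l j y := by
  simp only [l, map_sub]; ring

theorem mem' (H : HRep ι P) (x : Euc d) : x ∈ P ↔ ∀ j, 0 ≤ H.l j x := H.mem x

theorem int' (H : HRep ι P) (x : Euc d) : x ∈ interior P ↔ ∀ j, 0 < H.l j x := H.int x

theorem continuous_l (H : HRep ι P) (j : ι) : Continuous (H.l j) := by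
  unfold l; fun_prop

/-- Boundedness: there is no nonzero recession direction. -/
theorem recession (H : HRep ι P) {p : Euc d} (hp : p ∈ P) {v : Euc d}
    (hv : ∀ j, 0 ≤ H.g j v) : v = 0 := by
  by_contra hne
  obtain ⟨C, hC⟩ := H.bdd.exists_norm_le
  have hvn : 0 < ‖v‖ := norm_pos_iff.2 hne
  set t : ℝ := (|C| + ‖p‖ + 1) / ‖v‖ with ht
  have ht0 : 0 ≤ t := by positivity
  have hmem : p + t • v ∈ P := by
    rw [H.mem']
    intro j
    rw [l_add_smul]
    have := (H.mem' p).1 hp j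
    have := mul_nonneg ht0 (hv j)
    linarith
  have h1 := hC _ hmem
  have h2 : ‖t • v‖ ≤ ‖p + t • v‖ + ‖p‖ := by
    have := norm_sub_le (p + t • v) p
    simpa using this
  have h3 : ‖t • v‖ = |C| + ‖p‖ + 1 := by
    rw [norm_smul, Real.norm_of_nonneg ht0, ht, div_mul_cancel₀ _ hvn.ne']
  have := le_abs_self C
  linarith

theorem nonempty_index (H : HRep ι P) (hd : 0 < d) {p : Euc d} (hp : p ∈ P) : Nonempty ι := by
  by_contra h
  rw [not_nonempty_iff] at h
  have := H.recession hp (v := EuclideanSpace.single ⟨0, hd⟩ 1) (fun j => h.elim j)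
  have h2 := congrArg (fun x : Euc d => x ⟨0, hd⟩) this
  simp at h2

variable [Fintype ι]

/-- The set of active constraints. -/
def J (H : HRep ι P) (x : Euc d) : Finset ι := Finset.univ.filter (fun j => H.l j x = 0)

@[simp] theorem mem_J (H : HRep ι P) (x : Euc d) (j : ι) : j ∈ H.J x ↔ H.l j x = 0 := by
  simp [J]

/-- Active sets of points of `P`; they correspond to the faces. -/
def IsF (H : HRep ι P) (A : Finset ι) : Prop := ∃ x ∈ P, H.J x = A

/-- A point in the relative interior of the face. -/
def c (H : HRep ι P) (A : Finset ι) : Euc d := if h : H.IsF A then h.choose else 0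

theorem c_mem (H : HRep ι P) {A : Finset ι} (h : H.IsF A) : H.c A ∈ P := by
  rw [c, dif_pos h]; exact h.choose_spec.1

theorem J_c (H : HRep ι P) {A : Finset ι} (h : H.IsF A) : H.J (H.c A) = A := by
  rw [c, dif_pos h]; exact h.choose_spec.2

theorem l_c_eq_zero (H : HRep ι P) {A : Finset ι} (h : H.IsF A) {j : ι} (hj : j ∈ A) :
    H.l j (H.c A) = 0 := by
  rw [← mem_J, J_c H h]; exact hj

theorem l_c_pos (H : HRep ι P) {A : Finset ι} (h : H.IsF A) {j : ι} (hj : j ∉ A) :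
    0 < H.l j (H.c A) := by
  refine lt_of_le_of_ne ((H.mem' _).1 (c_mem H h) j) (fun h0 => hj ?_)
  rw [← J_c H h, mem_J]; exact h0.symm

theorem l_c_nonneg (H : HRep ι P) {A : Finset ι} (h : H.IsF A) (j : ι) :
    0 ≤ H.l j (H.c A) := (H.mem' _).1 (c_mem H h) j

/-- Homogenized functional. -/
def L (H : HRep ι P) (j : ι) : Euc d × ℝ →ₗ[ℝ] ℝ where
  toFun X := H.g j X.1 + H.b j * X.2
  map_add' X Y := by simp; ring
  map_smul' t X := by simp; ring

theorem L_apply (H : HRep ι P) (j : ι) (X : Euc d × ℝ) :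
    H.L j X = H.g j X.1 + H.b j * X.2 := rfl

theorem L_one (H : HRep ι P) (j : ι) (x : Euc d) : H.L j (x, 1) = H.l j x := by
  simp [L_apply, l]

theorem cone_pos (H : HRep ι P) [Nonempty ι] {p : Euc d} (hp : p ∈ interior P)
    {X : Euc d × ℝ} (hX : ∀ j, 0 ≤ H.L j X) (h0 : X ≠ 0) : 0 < X.2 := by
  by_contra hle
  push Not at hle
  have hgv : ∀ j, H.g j (X.1 - X.2 • p) = H.L j X + (-X.2) * H.l j p := by
    intro j; simp only [map_sub, map_smul, L_apply, l, smul_eq_mul]; ring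
  have hpos := (H.int' p).1 hp
  have hv : X.1 - X.2 • p = 0 := by
    apply H.recession (interior_subset hp)
    intro j
    rw [hgv]
    have := mul_nonneg (neg_nonneg.2 hle) (hpos j).le
    linarith [hX j]
  obtain ⟨j⟩ := ‹Nonempty ι›
  have h1 := hgv j
  rw [hv, map_zero] at h1
  have h2 : X.2 = 0 := by
    by_contra hne
    have : 0 < -X.2 := neg_pos.2 (lt_of_le_of_ne hle hne)
    have := mul_pos this (hpos j)
    linarith [hX j]
  rw [h2] at hv
  apply h0
  ext1
  · simpa using hv
  · simpa using h2

/-- Active set of a cone point. -/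
def Jh (H : HRep ι P) (X : Euc d × ℝ) : Finset ι := Finset.univ.filter (fun j => H.L j X = 0)

@[simp] theorem mem_Jh (H : HRep ι P) (X : Euc d × ℝ) (j : ι) : j ∈ H.Jh X ↔ H.L j X = 0 := by
  simp [Jh]

theorem isF_Jh (H : HRep ι P) [Nonempty ι] {p : Euc d} (hp : p ∈ interior P)
    {X : Euc d × ℝ} (hX : ∀ j, 0 ≤ H.L j X) (h0 : X ≠ 0) : H.IsF (H.Jh X) := by
  have hμ := H.cone_pos hp hX h0
  have hl : ∀ j, H.l j (X.2⁻¹ • X.1) = X.2⁻¹ * H.L j X := by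
    intro j; simp only [l, map_smul, smul_eq_mul, L_apply]; field_simp
  refine ⟨X.2⁻¹ • X.1, (H.mem' _).2 fun j => ?_, ?_⟩
  · rw [hl]; exact mul_nonneg (inv_pos.2 hμ).le (hX j)
  · ext j; simp [hl, hμ.ne.symm]

/-- Every cone point is a positive combination along a chain of faces. -/
theorem cover (H : HRep ι P) [Nonempty ι] {p : Euc d} (hp : p ∈ interior P) (n : ℕ) :
    ∀ X : Euc d × ℝ, (∀ j, 0 ≤ H.L j X) → X ≠ 0 → (H.Jh X)ᶜ.card = n →
    ∃ m : ℕ, ∃ A : Fin (m + 1) → Finset ι, StrictMono A ∧ (∀ i, H.IsF (A i)) ∧ A 0 = H.Jh X ∧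
      ∃ lam : Fin (m + 1) → ℝ, (∀ i, 0 < lam i) ∧
        X = ∑ i, lam i • ((H.c (A i), 1) : Euc d × ℝ) := by
  induction n using Nat.strong_induction_on with
  | _ n ih =>
    intro X hX h0 hn
    set A := H.Jh X with hA
    have hAF : H.IsF A := H.isF_Jh hp hX h0
    have hne : (Aᶜ).Nonempty := by
      rw [Finset.nonempty_iff_ne_empty]
      intro hemp
      have hall : ∀ j, H.L j X = 0 := by
        intro j
        rw [← mem_Jh, ← hA]
        by_contra hj
        have : j ∈ Aᶜ := by simpa using hj
        rw [hemp] at this; simp at this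
      have h1 := H.cone_pos hp hX h0
      have h2 := H.cone_pos hp (X := -X) (fun j => by simp [hall]) (by simpa using h0)
      simp at h2; linarith
    obtain ⟨j0, hj0, hmin⟩ := Finset.exists_min_image Aᶜ (fun j => H.L j X / H.l j (H.c A)) hne
    have hj0' : j0 ∉ A := by simpa using hj0
    have hXpos : ∀ j, j ∉ A → 0 < H.L j X := fun j hj =>
      lt_of_le_of_ne (hX j) (fun h => hj (by rw [hA, mem_Jh]; exact h.symm))
    set lam0 := H.L j0 X / H.l j0 (H.c A) with hlam0
    have hlampos : 0 < lam0 := div_pos (hXpos _ hj0') (H.l_c_pos hAF hj0')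
    set Y : Euc d × ℝ := X - lam0 • ((H.c A, 1) : Euc d × ℝ) with hY
    have hLY : ∀ j, H.L j Y = H.L j X - lam0 * H.l j (H.c A) := by
      intro j; rw [hY, map_sub, map_smul, L_one, smul_eq_mul]
    have hYA : ∀ j ∈ A, H.L j Y = 0 := by
      intro j hj
      rw [hLY, H.l_c_eq_zero hAF hj]
      have : H.L j X = 0 := by rw [← mem_Jh]; exact hj
      rw [this]; simp
    have hYn : ∀ j, 0 ≤ H.L j Y := by
      intro j
      by_cases hj : j ∈ A
      · rw [hYA j hj]
      · have h1 := hmin j (by simpa using hj)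
        rw [le_div_iff₀ (H.l_c_pos hAF hj)] at h1
        rw [hLY]; linarith
    have hYj0 : H.L j0 Y = 0 := by
      rw [hLY, hlam0, div_mul_cancel₀ _ (H.l_c_pos hAF hj0').ne', sub_self]
    have hXY : X = lam0 • ((H.c A, 1) : Euc d × ℝ) + Y := by rw [hY]; abel
    have hss : A ⊂ H.Jh Y := by
      rw [Finset.ssubset_iff_of_subset (fun j hj => by simpa using hYA j hj)]
      exact ⟨j0, by simpa using hYj0, hj0'⟩
    by_cases hY0 : Y = 0
    · refine ⟨0, fun _ => A, fun i j hij => absurd hij (by omega), fun _ => hAF, rfl, fun _ => lam0,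
        fun _ => hlampos, ?_⟩
      rw [hXY, hY0]; simp
    · obtain ⟨m, B, hB, hBF, hB0, mu, hmu, hsum⟩ := ih (H.Jh Y)ᶜ.card (by
        rw [← hn]
        exact Finset.card_lt_card (Finset.compl_ssubset_compl.2 hss)) Y hYn hY0 rfl
      refine ⟨m + 1, Fin.cons A B, ?_, ?_, rfl, Fin.cons lam0 mu, ?_, ?_⟩
      · rw [Fin.strictMono_iff_lt_succ]
        intro i
        refine Fin.cases ?_ (fun i => ?_) i
        · simp only [Fin.castSucc_zero, Fin.cons_zero, Fin.cons_succ]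
          rw [hB0]; exact hss
        · rw [← Fin.succ_castSucc]
          simp only [Fin.cons_succ]
          exact hB (Fin.castSucc_lt_succ)
      · intro i
        refine Fin.cases ?_ (fun i => ?_) i
        · exact hAF
        · simpa using hBF i
      · intro i
        refine Fin.cases ?_ (fun i => ?_) i
        · exact hlampos
        · simpa using hmu i
      · rw [Fin.sum_univ_succ]
        simp only [Fin.cons_zero, Fin.cons_succ]
        rw [← hsum]; exact hXY

theorem Jh_sum (H : HRep ι P) {m : ℕ} {A : Fin (m + 1) → Finset ι} (hA : StrictMono A)
    (hAF : ∀ i, H.IsF (A i)) {lam : Fin (m + 1) → ℝ} (hl : ∀ i, 0 < lam i) :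
    H.Jh (∑ i, lam i • ((H.c (A i), 1) : Euc d × ℝ)) = A 0 := by
  ext j
  rw [mem_Jh, map_sum]
  simp only [map_smul, L_one, smul_eq_mul]
  constructor
  · intro h
    rw [Finset.sum_eq_zero_iff_of_nonneg
      (fun i _ => mul_nonneg (hl i).le (H.l_c_nonneg (hAF i) j))] at h
    have h0 := h 0 (Finset.mem_univ _)
    by_contra hj
    have := mul_pos (hl 0) (H.l_c_pos (hAF 0) hj)
    linarith
  · intro hj
    apply Finset.sum_eq_zero
    intro i _
    rw [H.l_c_eq_zero (hAF i) (hA.monotone (Fin.zero_le i) hj), mul_zero]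

/-- Uniqueness of the chain. -/
theorem chain_unique (H : HRep ι P) (m : ℕ) :
    ∀ (A B : Fin (m + 1) → Finset ι), StrictMono A → StrictMono B → (∀ i, H.IsF (A i)) →
    (∀ i, H.IsF (B i)) → ∀ (lam mu : Fin (m + 1) → ℝ), (∀ i, 0 < lam i) → (∀ i, 0 < mu i) →
    ∑ i, lam i • ((H.c (A i), 1) : Euc d × ℝ) = ∑ i, mu i • ((H.c (B i), 1) : Euc d × ℝ) →
    A = B := by
  induction m with
  | zero =>
    intro A B hA hB hAF hBF lam mu hl hm h
    have h0 : A 0 = B 0 := by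
      rw [← H.Jh_sum hA hAF hl, h, H.Jh_sum hB hBF hm]
    ext1 i
    have hi : i = 0 := Fin.ext (by omega)
    rw [hi, h0]
  | succ m ih =>
    have aux : ∀ (A B : Fin (m + 1 + 1) → Finset ι), StrictMono A → StrictMono B →
        (∀ i, H.IsF (A i)) → (∀ i, H.IsF (B i)) → ∀ (lam mu : Fin (m + 1 + 1) → ℝ),
        (∀ i, 0 < lam i) → (∀ i, 0 < mu i) →
        ∑ i, lam i • ((H.c (A i), 1) : Euc d × ℝ) =
          ∑ i, mu i • ((H.c (B i), 1) : Euc d × ℝ) → A 0 = B 0 → mu 0 ≤ lam 0 := by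
      intro A B hA hB hAF hBF lam mu hl hm h h0
      have hlt : A 0 < A 1 := hA Fin.zero_lt_one
      obtain ⟨j, hj1, hj0⟩ := Finset.exists_of_ssubset hlt
      have h1 := congrArg (H.L j) h
      rw [map_sum, map_sum] at h1
      simp only [map_smul, L_one, smul_eq_mul] at h1
      rw [Fin.sum_univ_succ, Fin.sum_univ_succ (fun i => mu i * _)] at h1
      have h2 : ∑ i : Fin (m + 1), lam i.succ * H.l j (H.c (A i.succ)) = 0 := by
        apply Finset.sum_eq_zero
        intro i _
        have : A 1 ≤ A i.succ := hA.monotone (by rw [← Fin.succ_zero_eq_one]; exact Fin.succ_le_succ_iff.2 (Fin.zero_le i))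
        rw [H.l_c_eq_zero (hAF _) (this hj1), mul_zero]
      have h3 : 0 ≤ ∑ i : Fin (m + 1), mu i.succ * H.l j (H.c (B i.succ)) :=
        Finset.sum_nonneg fun i _ => mul_nonneg (hm _).le (H.l_c_nonneg (hBF _) j)
      rw [h2, ← h0] at h1
      have hp := H.l_c_pos (hAF 0) hj0
      by_contra hlt
      push Not at hlt
      nlinarith
    intro A B hA hB hAF hBF lam mu hl hm h
    have h0 : A 0 = B 0 := by
      rw [← H.Jh_sum hA hAF hl, h, H.Jh_sum hB hBF hm]
    have e0 : lam 0 = mu 0 := le_antisymm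
      (aux B A hB hA hBF hAF mu lam hm hl h.symm h0.symm) (aux A B hA hB hAF hBF lam mu hl hm h h0)
    rw [Fin.sum_univ_succ, Fin.sum_univ_succ (fun i => mu i • _), h0, e0] at h
    have h' := add_left_cancel h
    have := ih (fun i => A i.succ) (fun i => B i.succ)
      (fun i j hij => hA (Fin.succ_lt_succ_iff.2 hij))
      (fun i j hij => hB (Fin.succ_lt_succ_iff.2 hij)) (fun i => hAF _) (fun i => hBF _)
      (fun i => lam i.succ) (fun i => mu i.succ) (fun i => hl _) (fun i => hm _) h'
    ext1 i
    refine Fin.cases h0 (fun i => ?_) i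
    exact congrFun this i

end HRep

/-! ### Faces and flags -/

namespace HRep

set_option linter.unusedSectionVars false
variable {d : ℕ} {ι : Type} {P : Set (Euc d)} [Fintype ι]

/-- The face with prescribed active constraints. -/
def Face (H : HRep ι P) (A : Finset ι) : Set (Euc d) := {x | x ∈ P ∧ ∀ j ∈ A, H.l j x = 0}

theorem isF_ne_univ (H : HRep ι P) [Nonempty ι] {p : Euc d} (hp : p ∈ interior P)
    {A : Finset ι} (hA : H.IsF A) : A ≠ Finset.univ := by
  rintro rfl
  have h0 : ∀ j, H.l j (H.c Finset.univ) = 0 := fun j => H.l_c_eq_zero hA (Finset.mem_univ j)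
  have hpos := (H.int' p).1 hp
  have h1 : p - H.c Finset.univ = 0 := by
    apply H.recession (interior_subset hp)
    intro j
    rw [g_sub, h0, sub_zero]; exact (hpos j).le
  obtain ⟨j⟩ := ‹Nonempty ι›
  have h2 := hpos j
  rw [sub_eq_zero.1 h1, h0] at h2
  exact lt_irrefl _ h2

theorem isF_empty (H : HRep ι P) {p : Euc d} (hp : p ∈ interior P) : H.IsF ∅ := by
  refine ⟨p, interior_subset hp, ?_⟩
  ext j
  simp [((H.int' p).1 hp j).ne']

theorem c_mem_Face (H : HRep ι P) {A B : Finset ι} (hA : H.IsF A) (hBA : B ⊆ A) :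
    H.c A ∈ H.Face B := ⟨H.c_mem hA, fun _ hj => H.l_c_eq_zero hA (hBA hj)⟩

theorem Face_subset_iff (H : HRep ι P) {A B : Finset ι} (hA : H.IsF A) :
    H.Face A ⊆ H.Face B ↔ B ⊆ A := by
  constructor
  · intro h j hj
    have := (h (H.c_mem_Face hA subset_rfl)).2 j hj
    rw [← H.J_c hA, mem_J]; exact this
  · rintro h x ⟨hx, hxA⟩
    exact ⟨hx, fun j hj => hxA j (h hj)⟩

theorem isFace_Face (H : HRep ι P) {A : Finset ι} (hA : H.IsF A) : IsFace P (H.Face A) := by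
  refine ⟨⟨_, H.c_mem_Face hA subset_rfl⟩, ?_, ?_, ?_⟩
  · have : H.Face A = (⋂ j, {x | 0 ≤ H.l j x}) ∩ ⋂ j ∈ A, {x | H.l j x = 0} := by
      ext x; simp [Face, H.mem']
    rw [this]
    refine IsClosed.inter (isClosed_iInter fun j => isClosed_le continuous_const (H.continuous_l j))
      (isClosed_biInter fun j _ => isClosed_eq (H.continuous_l j) continuous_const)
  · rintro x ⟨hx, hxA⟩ y ⟨hy, hyA⟩ s t hs ht hst
    refine ⟨(H.mem' _).2 fun j => ?_, fun j hj => ?_⟩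
    · rw [H.l_comb _ _ _ _ _ hst]
      exact add_nonneg (mul_nonneg hs ((H.mem' _).1 hx j)) (mul_nonneg ht ((H.mem' _).1 hy j))
    · rw [H.l_comb _ _ _ _ _ hst, hxA j hj, hyA j hj]; simp
  · refine ⟨fun x hx => hx.1, ?_⟩
    rintro x hx y hy z ⟨hz, hzA⟩ ⟨s, t, hs, ht, hst, rfl⟩
    refine ⟨hx, fun j hj => ?_⟩
    have h := hzA j hj
    rw [H.l_comb _ _ _ _ _ hst] at h
    have h1 := mul_nonneg hs.le ((H.mem' _).1 hx j)
    have h2 := mul_nonneg ht.le ((H.mem' _).1 hy j)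
    have h3 : s * H.l j x = 0 := by linarith
    exact (mul_eq_zero.1 h3).resolve_left hs.ne'

theorem exists_Face (H : HRep ι P) {F : Set (Euc d)} (hF : IsFace P F) :
    ∃ A, H.IsF A ∧ F = H.Face A := by
  obtain ⟨hne, -, hconv, hext⟩ := hF
  obtain ⟨x, hxF, hxmin⟩ : ∃ x ∈ F, ∀ y ∈ F, (H.J x).card ≤ (H.J y).card := by
    have hne' : ((fun x => (H.J x).card) '' F).Nonempty := hne.image _
    obtain ⟨x, hx, hxe⟩ := Nat.sInf_mem hne'
    refine ⟨x, hx, fun y hy => ?_⟩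
    simp only at hxe
    rw [hxe]
    exact Nat.sInf_le ⟨y, hy, rfl⟩
  have hFP := hext.subset
  refine ⟨H.J x, ⟨x, hFP hxF, rfl⟩, Set.Subset.antisymm ?_ ?_⟩
  · intro y hy
    refine ⟨hFP hy, ?_⟩
    have hmid : (1 / 2 : ℝ) • x + (1 / 2 : ℝ) • y ∈ F :=
      hconv hxF hy (by norm_num) (by norm_num) (by norm_num)
    have hl : ∀ j, H.l j ((1 / 2 : ℝ) • x + (1 / 2 : ℝ) • y) = 1 / 2 * H.l j x + 1 / 2 * H.l j y :=
      fun j => H.l_comb _ _ _ _ _ (by norm_num)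
    have hnx := (H.mem' _).1 (hFP hxF)
    have hny := (H.mem' _).1 (hFP hy)
    have hsub : H.J ((1 / 2 : ℝ) • x + (1 / 2 : ℝ) • y) ⊆ H.J x := by
      intro j hj
      rw [mem_J, hl] at hj
      rw [mem_J]
      linarith [hnx j, hny j]
    have heq := Finset.eq_of_subset_of_card_le hsub (hxmin _ hmid)
    intro j hj
    rw [← heq, mem_J, hl] at hj
    linarith [hnx j, hny j]
  · rintro y ⟨hy, hyJ⟩
    have hnx := (H.mem' _).1 (hFP hxF)
    have hev : ∀ᶠ ε in 𝓝[>] (0 : ℝ), ∀ j, 0 ≤ H.l j x + ε * H.g j (x - y) := by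
      rw [eventually_all]
      intro j
      by_cases hj : H.l j x = 0
      · filter_upwards with ε
        rw [g_sub, hj, hyJ j ((H.mem_J x j).2 hj)]; simp
      · have hpos : 0 < H.l j x := lt_of_le_of_ne (hnx j) (Ne.symm hj)
        have hc : ContinuousAt (fun ε : ℝ => H.l j x + ε * H.g j (x - y)) 0 := by fun_prop
        have := hc.eventually (lt_mem_nhds (a := 0) (by simpa using hpos))
        exact (this.filter_mono nhdsWithin_le_nhds).mono fun _ h => le_of_lt h
    obtain ⟨ε, hε, hεpos⟩ := (hev.and self_mem_nhdsWithin).exists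
    have hεpos : 0 < ε := hεpos
    have hz : x + ε • (x - y) ∈ P := by
      rw [H.mem']; intro j; rw [l_add_smul]; exact hε j
    refine hext.left_mem_of_mem_openSegment hy hz hxF
      ⟨ε / (1 + ε), 1 / (1 + ε), by positivity, by positivity, by field_simp; ring, ?_⟩
    have h1 : (1 + ε) ≠ 0 := by positivity
    have : (1 + ε)⁻¹ * (1 + ε) = 1 := inv_mul_cancel₀ h1
    calc (ε / (1 + ε)) • y + (1 / (1 + ε)) • (x + ε • (x - y))
        = ((1 + ε)⁻¹ * (1 + ε)) • x := by
          rw [div_eq_mul_inv, div_eq_mul_inv]; module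
      _ = x := by rw [this, one_smul]

theorem g_direction (H : HRep ι P) {B : Finset ι} {j : ι} (hj : j ∈ B) {v : Euc d}
    (hv : v ∈ (affineSpan ℝ (H.Face B)).direction) : H.g j v = 0 := by
  rw [direction_affineSpan, vectorSpan_def] at hv
  have hle : Submodule.span ℝ (H.Face B -ᵥ H.Face B) ≤ LinearMap.ker (H.g j : Euc d →ₗ[ℝ] ℝ) := by
    rw [Submodule.span_le]
    rintro w ⟨x, hx, y, hy, rfl⟩
    simp only [vsub_eq_sub, SetLike.mem_coe, LinearMap.mem_ker, ContinuousLinearMap.coe_coe]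
    rw [g_sub, hx.2 j hj, hy.2 j hj, sub_zero]
  simpa using hle hv

theorem dim_lt (H : HRep ι P) {A B : Finset ι} (hA : H.IsF A) (hB : H.IsF B) (h : A ⊂ B) :
    faceDim (H.Face B) < faceDim (H.Face A) := by
  unfold faceDim
  apply Submodule.finrank_lt_finrank_of_lt
  have hsub : H.Face B ⊆ H.Face A := (H.Face_subset_iff hB).2 h.subset
  refine lt_of_le_of_ne (AffineSubspace.direction_le (affineSpan_mono ℝ hsub)) (fun heq => ?_)
  obtain ⟨j, hjB, hjA⟩ := Finset.exists_of_ssubset h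
  have hmem : H.c A - H.c B ∈ (affineSpan ℝ (H.Face A)).direction := by
    rw [← vsub_eq_sub]
    exact AffineSubspace.vsub_mem_direction
      (subset_affineSpan ℝ _ (H.c_mem_Face hA subset_rfl))
      (subset_affineSpan ℝ _ (H.c_mem_Face hB h.subset))
  rw [← heq] at hmem
  have h1 := H.g_direction hjB hmem
  rw [g_sub, H.l_c_eq_zero hB hjB] at h1
  have := H.l_c_pos hA hjA
  linarith

theorem faceDim_le (F : Set (Euc d)) : faceDim F ≤ d := by
  unfold faceDim
  calc _ ≤ Module.finrank ℝ (Euc d) := Submodule.finrank_le _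
    _ = d := by simp

/-- Maximal chains of faces, from the polytope down to a vertex. -/
def Chains (H : HRep ι P) : Set (Fin (d + 1) → Finset ι) :=
  {A | StrictMono A ∧ ∀ i, H.IsF (A i)}

theorem chain_dim (H : HRep ι P) {A : Fin (d + 1) → Finset ι} (hA : A ∈ H.Chains)
    (i : Fin (d + 1)) : faceDim (H.Face (A i)) + i = d := by
  have hanti : Antitone (fun i : Fin (d + 1) => faceDim (H.Face (A i)) + (i : ℕ)) := by
    rw [Fin.antitone_iff_succ_le]
    intro i
    have := H.dim_lt (hA.2 _) (hA.2 _) (hA.1 (Fin.castSucc_lt_succ (i := i)))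
    simp only [Fin.val_succ, Fin.val_castSucc]
    omega
  have h1 := hanti (Fin.zero_le i)
  have h2 := hanti (Fin.le_last i)
  have h3 := faceDim_le (H.Face (A 0))
  simp only [Fin.val_zero, Fin.val_last] at h1 h2
  omega

theorem chain_zero (H : HRep ι P) {p : Euc d} (hp : p ∈ interior P)
    {A : Fin (d + 1) → Finset ι} (hA : A ∈ H.Chains) : A 0 = ∅ := by
  by_contra hne
  have h1 := H.dim_lt (H.isF_empty hp) (hA.2 0)
    (Finset.ssubset_iff_subset_ne.2 ⟨Finset.empty_subset _, Ne.symm hne⟩)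
  have h2 := H.chain_dim hA 0
  have h3 := faceDim_le (H.Face ∅)
  simp at h2
  omega

theorem flagSet_eq (H : HRep ι P) :
    flagSet d P = (fun A i => H.Face (A (Fin.rev i))) '' H.Chains := by
  ext f
  constructor
  · rintro ⟨hf, hmono⟩
    choose A hAF hA using fun i => H.exists_Face (hf i).1
    refine ⟨fun i => A (Fin.rev i), ⟨?_, fun i => hAF _⟩, ?_⟩
    · intro i j hij
      have hr : Fin.rev j < Fin.rev i := Fin.rev_lt_rev.2 hij
      have hsub := hmono _ _ hr.le
      have hs2 := hsub
      rw [hA, hA (Fin.rev i), H.Face_subset_iff (hAF _)] at hs2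
      refine Finset.ssubset_iff_subset_ne.2 ⟨hs2, fun heq => ?_⟩
      have heq : A (Fin.rev i) = A (Fin.rev j) := heq
      have d1 := (hf (Fin.rev j)).2
      have d2 := (hf (Fin.rev i)).2
      rw [hA, ← heq, ← hA, d2] at d1
      exact hr.ne (Fin.ext d1.symm)
    · funext i
      simp only [Fin.rev_rev]
      exact (hA i).symm
  · rintro ⟨A, hA, rfl⟩
    refine ⟨fun i => ⟨H.isFace_Face (hA.2 _), ?_⟩, fun i j hij => ?_⟩
    · have := H.chain_dim hA (Fin.rev i)
      simp only [Fin.val_rev] at this ⊢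
      omega
    · exact (H.Face_subset_iff (hA.2 _)).2 (hA.1.monotone (Fin.rev_le_rev.2 hij))

theorem ncard_flagSet (H : HRep ι P) : (flagSet d P).ncard = H.Chains.ncard := by
  rw [H.flagSet_eq]
  apply Set.InjOn.ncard_image
  intro A hA B hB h
  funext i
  have h1 := congrFun h (Fin.rev i)
  simp only [Fin.rev_rev] at h1
  exact subset_antisymm ((H.Face_subset_iff (hB.2 i)).1 h1.ge)
    ((H.Face_subset_iff (hA.2 i)).1 h1.le)

end HRep

/-- The index function of a chain. -/
theorem exists_index {ι : Type*} [Fintype ι] {d : ℕ} (A : Fin (d + 1) → Finset ι)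
    (hA : StrictMono A) (h0 : A 0 = ∅) (hl : A (Fin.last d) ≠ Finset.univ) :
    ∃ k : ι → Fin (d + 1), Function.Surjective k ∧ ∀ j i, j ∈ A i ↔ k j < i := by
  have hex : ∀ j, ∃ k : Fin (d + 1), ∀ i, j ∈ A i ↔ k < i := by
    intro j
    let S : Finset (Fin (d + 1)) := Finset.univ.filter (fun i => j ∉ A i)
    have hS : S.Nonempty := ⟨0, by simp [S, h0]⟩
    refine ⟨S.max' hS, fun i => ⟨fun h => ?_, fun h => ?_⟩⟩
    · have hm : S.max' hS ∈ S := Finset.max'_mem _ _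
      simp only [S, Finset.mem_filter, Finset.mem_univ, true_and] at hm
      by_contra hle
      push Not at hle
      exact hm (hA.monotone hle h)
    · by_contra hj
      have : i ∈ S := by simp [S, hj]
      exact absurd (Finset.le_max' S i this) (not_le.2 h)
  choose k hk using hex
  refine ⟨k, fun i => ?_, hk⟩
  refine Fin.lastCases ?_ (fun i => ?_) i
  · obtain ⟨j, hj⟩ : ∃ j, j ∉ A (Fin.last d) := by
      by_contra hcon
      push Not at hcon
      exact hl (Finset.eq_univ_iff_forall.2 hcon)
    refine ⟨j, ?_⟩
    rw [hk] at hj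
    exact le_antisymm (Fin.le_last _) (not_lt.1 hj)
  · obtain ⟨j, hj1, hj2⟩ := Finset.exists_of_ssubset (hA (Fin.castSucc_lt_succ (i := i)))
    rw [hk] at hj1 hj2
    refine ⟨j, le_antisymm ?_ (not_lt.1 hj2)⟩
    exact Fin.le_castSucc_iff.2 hj1

/-! ### The simplex -/

/-- Half-space representation of a simplex from barycentric coordinates. -/
def simplexHRep {d : ℕ} (B : AffineBasis (Fin (d + 1)) ℝ (Euc d)) :
    HRep (Fin (d + 1)) (convexHull ℝ (Set.range B)) where
  g j := LinearMap.toContinuousLinearMap (B.coord j).linear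
  b j := B.coord j 0
  mem x := by
    rw [B.convexHull_eq_nonneg_coord]
    have : ∀ j, B.coord j x = (B.coord j).linear x + B.coord j 0 := fun j => by
      rw [AffineMap.decomp (B.coord j)]; simp
    simp [this]
  int x := by
    rw [B.interior_convexHull]
    have : ∀ j, B.coord j x = (B.coord j).linear x + B.coord j 0 := fun j => by
      rw [AffineMap.decomp (B.coord j)]; simp
    simp [this]
  bdd := (isBounded_convexHull).2 (Set.finite_range _).isBounded

theorem simplexHRep_l {d : ℕ} (B : AffineBasis (Fin (d + 1)) ℝ (Euc d)) (j : Fin (d + 1))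
    (x : Euc d) : (simplexHRep B).l j x = B.coord j x := by
  have : B.coord j x = (B.coord j).linear x + B.coord j 0 := by
    rw [AffineMap.decomp (B.coord j)]; simp
  rw [this]; rfl

theorem simplex_isF {d : ℕ} (B : AffineBasis (Fin (d + 1)) ℝ (Euc d)) (A : Finset (Fin (d + 1)))
    (hA : A ≠ Finset.univ) : (simplexHRep B).IsF A := by
  have hne : (Aᶜ).Nonempty := by
    rw [Finset.nonempty_iff_ne_empty, ne_eq, Finset.compl_eq_empty_iff]; exact hA
  have hcoord : ∀ j, B.coord j (Finset.centroid ℝ Aᶜ B) = if j ∈ A then 0 else (Aᶜ.card : ℝ)⁻¹ := by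
    intro j
    split_ifs with hj
    · exact B.coord_apply_combination_of_notMem (by simpa using hj)
        (Finset.sum_centroidWeights_eq_one_of_nonempty ℝ _ hne)
    · exact B.coord_apply_centroid (by simpa using hj)
  have hc : (0 : ℝ) < (Aᶜ.card : ℝ)⁻¹ := by
    have := Finset.card_pos.2 hne
    positivity
  refine ⟨Finset.centroid ℝ Aᶜ B, ?_, ?_⟩
  · rw [HRep.mem' (simplexHRep B)]
    intro j
    rw [simplexHRep_l, hcoord]
    split_ifs
    · exact le_rfl
    · exact hc.le
  · ext j
    rw [HRep.mem_J, simplexHRep_l, hcoord]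
    split_ifs with hj
    · simp [hj]
    · simp only [hj, iff_false]; exact hc.ne'

theorem simplex_ncard {d : ℕ} (B : AffineBasis (Fin (d + 1)) ℝ (Euc d)) :
    (flagSet d (convexHull ℝ (Set.range B))).ncard = (d + 1).factorial := by
  have hp : Finset.univ.centroid ℝ B ∈ interior (convexHull ℝ (Set.range B)) :=
    B.centroid_mem_interior_convexHull
  rw [(simplexHRep B).ncard_flagSet]
  let Ψ : Equiv.Perm (Fin (d + 1)) → Fin (d + 1) → Finset (Fin (d + 1)) :=
    fun κ i => Finset.univ.filter (fun j => κ j < i)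
  have hΨ : Function.Injective Ψ := by
    intro κ κ' h
    have hiff : ∀ i j, κ j < i ↔ κ' j < i := by
      intro i j
      have := congrArg (fun f => j ∈ f i) h
      simpa [Ψ] using this
    ext1 j
    refine le_antisymm ?_ ?_
    · by_contra hlt
      push Not at hlt
      exact lt_irrefl _ ((hiff _ _).2 hlt)
    · by_contra hlt
      push Not at hlt
      exact lt_irrefl _ ((hiff _ _).1 hlt)
  have himg : (simplexHRep B).Chains = Ψ '' Set.univ := by
    ext A
    constructor
    · intro hA
      obtain ⟨k, hk, hkA⟩ := exists_index A hA.1 ((simplexHRep B).chain_zero hp hA)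
        ((simplexHRep B).isF_ne_univ hp (hA.2 _))
      have hb : Function.Bijective k := ⟨Finite.injective_iff_surjective.2 hk, hk⟩
      refine ⟨Equiv.ofBijective k hb, Set.mem_univ _, ?_⟩
      funext i
      ext j
      simp [Ψ, hkA]
    · rintro ⟨κ, -, rfl⟩
      refine ⟨fun i i' hii => ?_, fun i => simplex_isF B _ ?_⟩
      · rw [Finset.ssubset_iff_of_subset]
        · exact ⟨κ.symm i, by simp [Ψ, hii], by simp [Ψ]⟩
        · intro j hj
          simp only [Ψ, Finset.mem_filter, Finset.mem_univ, true_and] at hj ⊢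
          exact hj.trans hii
      · intro h
        have : κ.symm i ∈ Ψ κ i := by rw [h]; exact Finset.mem_univ _
        simp [Ψ] at this
  rw [himg, Set.ncard_image_of_injective _ hΨ, Set.ncard_univ, Nat.card_perm, Nat.card_fin]

/-! ### Formulas for the Finsler norm and the Hilbert ball -/

namespace HRep

set_option linter.unusedSectionVars false
variable {d : ℕ} {ι : Type} {P : Set (Euc d)} [Fintype ι]

theorem line (H : HRep ι P) [Nonempty ι] {x : Euc d} (hx : x ∈ interior P) {v : Euc d}
    (hv : v ≠ 0) : ∃ M M' : ℝ, 0 < M ∧ 0 < M' ∧ (∀ j, -(H.g j v / H.l j x) ≤ M) ∧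
      (∀ j, H.g j v / H.l j x ≤ M') ∧ (∃ j, -(H.g j v / H.l j x) = M) ∧
      (∃ j, H.g j v / H.l j x = M') ∧
      ∀ t : ℝ, x + t • v ∈ interior P ↔ -(1 / M') < t ∧ t < 1 / M := by
  have hl := (H.int' x).1 hx
  obtain ⟨j0, hj0⟩ := Finite.exists_max (fun j => -(H.g j v / H.l j x))
  obtain ⟨j1, hj1⟩ := Finite.exists_max (fun j => H.g j v / H.l j x)
  have hM : 0 < -(H.g j0 v / H.l j0 x) := by
    by_contra hcon
    push Not at hcon
    apply hv
    apply H.recession (interior_subset hx)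
    intro j
    have h1 := (hj0 j).trans hcon
    have h2 : 0 ≤ H.g j v / H.l j x := by linarith
    have h3 := mul_nonneg h2 (hl j).le
    rwa [div_mul_cancel₀ _ (hl j).ne'] at h3
  have hM' : 0 < H.g j1 v / H.l j1 x := by
    by_contra hcon
    push Not at hcon
    apply hv
    rw [← neg_eq_zero]
    apply H.recession (interior_subset hx)
    intro j
    have h1 := (hj1 j).trans hcon
    have h2 : 0 ≤ -(H.g j v / H.l j x) := by linarith
    have h3 := mul_nonneg h2 (hl j).le
    rw [neg_mul, div_mul_cancel₀ _ (hl j).ne'] at h3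
    simpa using h3
  refine ⟨_, _, hM, hM', hj0, hj1, ⟨j0, rfl⟩, ⟨j1, rfl⟩, fun t => ?_⟩
  set M := -(H.g j0 v / H.l j0 x) with hMd
  set M' := H.g j1 v / H.l j1 x with hMd'
  have hiff : ∀ j, 0 < H.l j (x + t • v) ↔ 0 < 1 + t * (H.g j v / H.l j x) := by
    intro j
    rw [l_add_smul]
    have : H.l j x + t * H.g j v = H.l j x * (1 + t * (H.g j v / H.l j x)) := by
      have := (hl j).ne'
      field_simp
    rw [this]
    exact mul_pos_iff_of_pos_left (hl j)
  have e1 : -(1 / M') < t ↔ 0 < 1 + t * M' := by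
    rw [← neg_div, div_lt_iff₀ hM']
    constructor <;> intro h <;> linarith
  have e2 : t < 1 / M ↔ 0 < 1 - t * M := by
    rw [lt_div_iff₀ hM]
    constructor <;> intro h <;> linarith
  rw [e1, e2, H.int']
  simp only [hiff]
  constructor
  · intro h
    refine ⟨h j1, ?_⟩
    have := h j0
    rw [hMd]; linarith
  · rintro ⟨h1, h2⟩ j
    have a1 := hj0 j
    have a2 := hj1 j
    rcases le_total 0 t with ht | ht
    · nlinarith
    · nlinarith

theorem finsler_lt_one (H : HRep ι P) [Nonempty ι] {x : Euc d} (hx : x ∈ interior P) (v : Euc d) :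
    finslerNorm (interior P) x v < 1 ↔
      ∀ i j, H.g i v / H.l i x - H.g j v / H.l j x < 2 := by
  by_cases hv : v = 0
  · subst hv; simp [finslerNorm]
  · obtain ⟨M, M', hM, hM', h1, h2, ⟨j0, hj0⟩, ⟨j1, hj1⟩, hline⟩ := H.line hx hv
    have s1 : {t : ℝ | 0 < t ∧ x + t • v ∈ interior P} = Set.Ioo 0 (1 / M) := by
      ext t
      simp only [Set.mem_ofPred_eq, Set.mem_Ioo, hline]
      constructor
      · rintro ⟨a, -, b⟩; exact ⟨a, b⟩
      · rintro ⟨a, b⟩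
        have : 0 < 1 / M' := by positivity
        exact ⟨a, by linarith, b⟩
    have s2 : {t : ℝ | 0 < t ∧ x - t • v ∈ interior P} = Set.Ioo 0 (1 / M') := by
      ext t
      have : x - t • v = x + (-t) • v := by rw [neg_smul, sub_eq_add_neg]
      simp only [Set.mem_ofPred_eq, Set.mem_Ioo, this, hline]
      have : 0 < 1 / M := by positivity
      constructor
      · rintro ⟨a, b, c⟩; exact ⟨a, by linarith⟩
      · rintro ⟨a, b⟩
        exact ⟨a, by linarith, by linarith⟩
    rw [finslerNorm, if_neg hv, s1, s2, csSup_Ioo (by positivity), csSup_Ioo (by positivity),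
      one_div_one_div, one_div_one_div]
    constructor
    · intro h i j
      have := h1 j
      have := h2 i
      linarith
    · intro h
      have := h j1 j0
      linarith

theorem hilbert_le (H : HRep ι P) [Nonempty ι] {p q : Euc d} (hp : p ∈ interior P)
    (hq : q ∈ interior P) (R : ℝ) :
    hilbertDist (interior P) p q ≤ R ↔
      ∀ i j, H.l i q * H.l j p ≤ Real.exp (2 * R) * (H.l i p * H.l j q) := by
  have hlp := (H.int' p).1 hp
  by_cases hpq : p = q
  · subst hpq
    rw [hilbertDist, if_pos rfl]
    have : ∀ i j, (H.l i p * H.l j p ≤ Real.exp (2 * R) * (H.l i p * H.l j p) ↔ 0 ≤ R) := by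
      intro i j
      rw [le_mul_iff_one_le_left (mul_pos (hlp i) (hlp j)), Real.one_le_exp_iff]
      constructor <;> intro h <;> linarith
    simp only [this, forall_const]
  · have hv : q - p ≠ 0 := sub_ne_zero.2 (Ne.symm hpq)
    obtain ⟨M, M', hM, hM', h1, h2, ⟨j0, hj0⟩, ⟨j1, hj1⟩, hline⟩ := H.line hp hv
    have s1 : {t : ℝ | p + t • (q - p) ∈ interior P} = Set.Ioo (-(1 / M')) (1 / M) := by
      ext t
      simp only [Set.mem_ofPred_eq, Set.mem_Ioo, hline]
    have hlt : -(1 / M') < 1 / M := by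
      have : 0 < 1 / M := by positivity
      have : 0 < 1 / M' := by positivity
      linarith
    have hM1 : M < 1 := by
      have := (hline 1).1 (by simpa using hq)
      have := this.2
      rw [lt_div_iff₀ hM] at this
      linarith
    rw [hilbertDist, if_neg hpq, s1, csSup_Ioo hlt, csInf_Ioo hlt]
    have hexpr : (1 - -(1 / M')) / - -(1 / M') * (1 / M / (1 / M - 1)) = (1 + M') / (1 - M) := by
      have : 1 - M ≠ 0 := by linarith
      have h3 : 1 / M - 1 ≠ 0 := by
        rw [div_sub_one hM.ne']
        exact div_ne_zero this hM.ne'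
      field_simp
      ring
    have hpos : 0 < (1 + M') / (1 - M) := div_pos (by linarith) (by linarith)
    have hstep : 1 / 2 * Real.log ((1 - -(1 / M')) / - -(1 / M') * (1 / M / (1 / M - 1))) ≤ R ↔
        (1 + M') / (1 - M) ≤ Real.exp (2 * R) := by
      rw [hexpr, ← Real.log_le_iff_le_exp hpos]
      constructor <;> intro h <;> linarith
    rw [hstep, div_le_iff₀ (by linarith)]
    have ha : ∀ i, H.l i q = H.l i p * (1 + H.g i (q - p) / H.l i p) := by
      intro i
      rw [g_sub]
      have := (hlp i).ne'
      field_simp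
      ring
    have hiff : ∀ i j, (H.l i q * H.l j p ≤ Real.exp (2 * R) * (H.l i p * H.l j q)) ↔
        1 + H.g i (q - p) / H.l i p ≤ Real.exp (2 * R) * (1 + H.g j (q - p) / H.l j p) := by
      intro i j
      rw [ha i, ha j]
      generalize H.g i (q - p) / H.l i p = a
      generalize H.g j (q - p) / H.l j p = a'
      rw [show H.l i p * (1 + a) * H.l j p = (H.l i p * H.l j p) * (1 + a) by ring,
        show Real.exp (2 * R) * (H.l i p * (H.l j p * (1 + a'))) =
          (H.l i p * H.l j p) * (Real.exp (2 * R) * (1 + a')) by ring]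
      exact mul_le_mul_iff_right₀ (mul_pos (hlp i) (hlp j))
    simp only [hiff]
    have hE := Real.exp_pos (2 * R)
    constructor
    · intro h i j
      have a1 := h2 i
      have a2 := h1 j
      have : Real.exp (2 * R) * (1 - M) ≤ Real.exp (2 * R) * (1 + H.g j (q - p) / H.l j p) :=
        mul_le_mul_of_nonneg_left (by linarith) hE.le
      linarith
    · intro h
      have := h j1 j0
      rw [hj1] at this
      have h3 : H.g j0 (q - p) / H.l j0 p = -M := by linarith
      rw [h3] at this
      linarith

end HRep

/-! ### Analysis in one flag simplex: the real-variable part -/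

/-- Extend a vector by a last coordinate `0`. -/
def ex {d : ℕ} (t : Euc d) (i : Fin (d + 1)) : ℝ :=
  Fin.lastCases (motive := fun _ => ℝ) 0 (fun i => t i) i

@[simp] theorem ex_last {d : ℕ} (t : Euc d) : ex t (Fin.last d) = 0 := by simp [ex]

@[simp] theorem ex_castSucc {d : ℕ} (t : Euc d) (i : Fin d) : ex t i.castSucc = t i := by
  simp [ex]

theorem ex_add {d : ℕ} (s t : Euc d) (i : Fin (d + 1)) : ex (s + t) i = ex s i + ex t i := by
  refine Fin.lastCases ?_ (fun i => ?_) i <;> simp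

theorem ex_smul {d : ℕ} (c : ℝ) (t : Euc d) (i : Fin (d + 1)) : ex (c • t) i = c * ex t i := by
  refine Fin.lastCases ?_ (fun i => ?_) i <;> simp

/-- `ex` as a linear functional. -/
def exL {d : ℕ} (i : Fin (d + 1)) : Euc d →ₗ[ℝ] ℝ where
  toFun t := ex t i
  map_add' s t := ex_add s t i
  map_smul' c t := by simp [ex_smul]

theorem continuous_ex {d : ℕ} (i : Fin (d + 1)) : Continuous (fun t : Euc d => ex t i) :=
  (exL i).continuous_of_finiteDimensional

theorem abs_ex_le {d : ℕ} (t : Euc d) (i : Fin (d + 1)) : |ex t i| ≤ ‖t‖ := by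
  refine Fin.lastCases ?_ (fun i => ?_) i
  · simp
  · simp only [ex_castSucc]
    have := PiLp.norm_apply_le t i
    simpa using this

theorem measure_hyperplane {d : ℕ} (f : Euc d →ₗ[ℝ] ℝ) (hf : f ≠ 0) (c : ℝ) :
    volume {w : Euc d | f w = c} = 0 := by
  rcases Set.eq_empty_or_nonempty {w : Euc d | f w = c} with h | ⟨w0, hw0⟩
  · rw [h]; simp
  · have hw0 : f w0 = c := hw0
    have hs : {w : Euc d | f w = c} = (AffineSubspace.mk' w0 (LinearMap.ker f) : Set (Euc d)) := by
      ext w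
      simp only [Set.mem_ofPred_eq, SetLike.mem_coe, AffineSubspace.mem_mk', vsub_eq_sub,
        LinearMap.mem_ker, map_sub, hw0, sub_eq_zero]
    rw [hs]
    apply Measure.addHaar_affineSubspace
    intro htop
    have := congrArg AffineSubspace.direction htop
    rw [AffineSubspace.direction_mk', AffineSubspace.direction_top, LinearMap.ker_eq_top] at this
    exact hf this

theorem exL_sub_ne {d : ℕ} {i j : Fin (d + 1)} (hij : i ≠ j) : exL i - exL j ≠ 0 := by
  have aux : ∀ (i : Fin d) (j : Fin (d + 1)), i.castSucc ≠ j →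
      ex (EuclideanSpace.single i (1 : ℝ)) j = 0 := by
    intro i j
    refine Fin.lastCases ?_ (fun j => ?_) j
    · simp
    · intro h
      have : j ≠ i := fun h' => h (by rw [h'])
      simp [this]
  intro h
  revert hij h
  refine Fin.lastCases ?_ (fun i => ?_) i
  · refine Fin.lastCases ?_ (fun j => ?_) j
    · intro h; exact absurd rfl h
    · intro hij h
      have h1 := LinearMap.congr_fun h (EuclideanSpace.single j (1 : ℝ))
      simp [exL] at h1
  · intro hij h
    have h1 := LinearMap.congr_fun h (EuclideanSpace.single i (1 : ℝ))
    have h2 := aux i j hij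
    simp [exL, h2] at h1

/-- Successive differences. -/
def dl {d : ℕ} {M : Type*} [AddCommGroup M] (v : Fin (d + 1) → M) (i : Fin (d + 1)) : M :=
  Fin.lastCases (motive := fun _ => M) (v (Fin.last d)) (fun i => v i.castSucc - v i.succ) i

@[simp] theorem dl_last {d : ℕ} {M : Type*} [AddCommGroup M] (v : Fin (d + 1) → M) :
    dl v (Fin.last d) = v (Fin.last d) := by simp [dl]

@[simp] theorem dl_castSucc {d : ℕ} {M : Type*} [AddCommGroup M] (v : Fin (d + 1) → M)
    (i : Fin d) : dl v i.castSucc = v i.castSucc - v i.succ := by simp [dl]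

/-- Summation by parts. -/
theorem dl_abel {d : ℕ} {M : Type*} [AddCommGroup M] [Module ℝ M] (v : Fin (d + 1) → M)
    (τ : Fin (d + 1) → ℝ) :
    ∑ i, τ i • dl v i = τ 0 • v 0 + ∑ i : Fin d, (τ i.succ - τ i.castSucc) • v i.succ := by
  have h1 := Fin.sum_univ_castSucc (fun i => τ i • v i)
  have h2 := Fin.sum_univ_succ (fun i => τ i • v i)
  rw [Fin.sum_univ_castSucc]
  simp only [dl_castSucc, dl_last, smul_sub, sub_smul, Finset.sum_sub_distrib]
  rw [h1] at h2
  rw [← eq_sub_iff_add_eq'] at h2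
  rw [h2]; abel

/-- The coordinates `τ`. -/
def tau {d : ℕ} (R : ℝ) (t : Euc d) (i : Fin (d + 1)) : ℝ := Real.exp (-(R * ex t i))

theorem tau_pos {d : ℕ} (R : ℝ) (t : Euc d) (i : Fin (d + 1)) : 0 < tau R t i := Real.exp_pos _

@[simp] theorem tau_last {d : ℕ} (R : ℝ) (t : Euc d) : tau R t (Fin.last d) = 1 := by simp [tau]

@[simp] theorem tau_castSucc {d : ℕ} (R : ℝ) (t : Euc d) (i : Fin d) :
    tau R t i.castSucc = Real.exp (-(R * t i)) := by simp [tau]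

theorem tau_mono {d : ℕ} {R : ℝ} (hR : 0 ≤ R) {t : Euc d} (ht : StrictAnti (ex t)) :
    Monotone (tau R t) := by
  intro i j hij
  apply Real.exp_le_exp.2
  have := mul_le_mul_of_nonneg_left (ht.antitone hij) hR
  linarith

/-- The logarithmic derivative coordinates. -/
def al {d : ℕ} {ι : Type} (δ : ι → Fin (d + 1) → ℝ) (R : ℝ) (t w : Euc d) (j : ι) : ℝ :=
  (∑ i, ex w i * (tau R t i * δ j i)) / (∑ i, tau R t i * δ j i)

/-- The Finsler unit ball in the logarithmic coordinates. -/
def Bt {d : ℕ} {ι : Type} (δ : ι → Fin (d + 1) → ℝ) (R : ℝ) (t : Euc d) : Set (Euc d) :=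
  {w | ∀ i j, al δ R t w i - al δ R t w j < 2}

/-- The limiting unit ball. -/
def Nb (d : ℕ) : Set (Euc d) := {w | ∀ i j, ex w i - ex w j < 2}

/-- Combinatorial data of one flag simplex. -/
structure FlagData {d : ℕ} {ι : Type} (a : ι → Fin (d + 1) → ℝ) (k : ι → Fin (d + 1)) : Prop where
  surj : Function.Surjective k
  zero : ∀ j i, k j < i → a j i = 0
  pos : ∀ j i, i ≤ k j → 0 < a j i

namespace FlagData

variable {d : ℕ} {ι : Type} {a : ι → Fin (d + 1) → ℝ} {k : ι → Fin (d + 1)}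

theorem dl_zero (h : FlagData a k) (j : ι) (i : Fin (d + 1)) (hi : k j < i) : dl (a j) i = 0 := by
  revert hi
  refine Fin.lastCases ?_ (fun i => ?_) i
  · intro hi; simpa using h.zero j _ hi
  · intro hi
    rw [dl_castSucc, h.zero j _ hi, h.zero j _ (hi.trans Fin.castSucc_lt_succ), sub_zero]

theorem dl_k (h : FlagData a k) (j : ι) : dl (a j) (k j) = a j (k j) := by
  have : ∀ i, i = k j → dl (a j) i = a j i := by
    intro i
    refine Fin.lastCases ?_ (fun i => ?_) i
    · intro hi; simp
    · intro hi
      rw [dl_castSucc, h.zero j i.succ (by rw [← hi]; exact Fin.castSucc_lt_succ), sub_zero]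
  exact this _ rfl

theorem exists_lower [Finite ι] (h : FlagData a k) :
    ∃ m : ℝ, 0 < m ∧ ∀ j i, i ≤ k j → m ≤ a j i := by
  have hev : ∀ᶠ m in 𝓝[>] (0 : ℝ), ∀ j i, i ≤ k j → m ≤ a j i := by
    rw [eventually_all]; intro j
    rw [eventually_all]; intro i
    by_cases hi : i ≤ k j
    · have := (ge_mem_nhds (h.pos j i hi)).filter_mono (nhdsWithin_le_nhds (s := Set.Ioi 0))
      filter_upwards [this] with m hm _ using hm
    · exact Eventually.of_forall fun m h' => absurd h' hi
  obtain ⟨m, hm, hm0⟩ := (hev.and self_mem_nhdsWithin).exists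
  exact ⟨m, hm0, hm⟩

theorem sum_lower (h : FlagData a k) {m : ℝ} (hm : ∀ j i, i ≤ k j → m ≤ a j i)
    {τ : Fin (d + 1) → ℝ} (hτ0 : ∀ i, 0 < τ i) (hτ : Monotone τ) (j : ι) :
    m * τ (k j) ≤ ∑ i, τ i * dl (a j) i := by
  have h1 := dl_abel (a j) τ
  let u : Fin (d + 1) → ℝ := fun i => if i ≤ k j then m else 0
  have h2 := dl_abel u τ
  simp only [smul_eq_mul] at h1 h2
  have hu : ∑ i, τ i * dl u i = m * τ (k j) := by
    have : ∀ i, dl u i = if i = k j then m else 0 := by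
      intro i
      refine Fin.lastCases ?_ (fun i => ?_) i
      · simp only [dl_last, u]
        congr 1
        rw [eq_iff_iff]
        exact ⟨fun hh => le_antisymm hh (Fin.le_last _), fun hh => hh.le⟩
      · simp only [dl_castSucc, u]
        rcases lt_trichotomy i.castSucc (k j) with hh | hh | hh
        · rw [if_pos hh.le, if_pos (Fin.castSucc_lt_iff_succ_le.1 hh), if_neg hh.ne, sub_self]
        · rw [if_pos hh.le, if_neg (by rw [← hh]; exact not_le.2 Fin.castSucc_lt_succ), if_pos hh,
            sub_zero]
        · rw [if_neg (not_le.2 hh), if_neg (not_le.2 (hh.trans Fin.castSucc_lt_succ)),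
            if_neg hh.ne', sub_self]
    simp only [this, mul_ite, mul_zero, Finset.sum_ite_eq', Finset.mem_univ, if_true]
    ring
  have hle : ∀ i, u i ≤ a j i := by
    intro i
    by_cases hi : i ≤ k j
    · simp only [u, if_pos hi]; exact hm j i hi
    · simp only [u, if_neg hi]; exact (h.zero j i (not_le.1 hi)).ge
  rw [← hu, h1, h2]
  refine add_le_add (mul_le_mul_of_nonneg_left (hle 0) (hτ0 0).le)
    (Finset.sum_le_sum fun i _ => mul_le_mul_of_nonneg_left (hle _) ?_)
  exact sub_nonneg.2 (hτ Fin.castSucc_lt_succ.le)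

theorem abs_sum_le (h : FlagData a k) {τ : Fin (d + 1) → ℝ} (hτ0 : ∀ i, 0 < τ i)
    (hτ : Monotone τ) (j : ι) (w : Fin (d + 1) → ℝ) {c : ℝ} (hw : ∀ i, |w i| ≤ c) :
    |∑ i, w i * (τ i * dl (a j) i)| ≤ c * (∑ i, |dl (a j) i|) * τ (k j) := by
  refine (Finset.abs_sum_le_sum_abs _ _).trans ?_
  rw [mul_assoc, Finset.sum_mul, Finset.mul_sum]
  refine Finset.sum_le_sum fun i _ => ?_
  rw [abs_mul, abs_mul, abs_of_pos (hτ0 i)]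
  refine mul_le_mul (hw i) ?_ (by have := hτ0 i; positivity) ((abs_nonneg _).trans (hw i))
  by_cases hi : k j < i
  · rw [h.dl_zero j i hi]; simp
  · rw [mul_comm]
    exact mul_le_mul_of_nonneg_left (hτ (not_lt.1 hi)) (abs_nonneg _)

theorem tendsto_coef (h : FlagData a k) {t : Euc d} (ht : StrictAnti (ex t)) (j : ι)
    (i : Fin (d + 1)) :
    Tendsto (fun R => (tau R t i * dl (a j) i) / (∑ i, tau R t i * dl (a j) i)) atTop
      (𝓝 (if i = k j then 1 else 0)) := by
  have hak := h.pos j (k j) le_rfl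
  have hterm : ∀ i, Tendsto (fun R => (tau R t i / tau R t (k j)) * dl (a j) i) atTop
      (𝓝 (if i = k j then a j (k j) else 0)) := by
    intro i
    rcases lt_trichotomy i (k j) with hi | hi | hi
    · rw [if_neg hi.ne]
      have hpos : 0 < ex t i - ex t (k j) := sub_pos.2 (ht hi)
      have he : ∀ R, tau R t i / tau R t (k j) = Real.exp (-(R * (ex t i - ex t (k j)))) := by
        intro R; rw [tau, tau, ← Real.exp_sub]; congr 1; ring
      simp only [he]
      have h1 : Tendsto (fun R : ℝ => Real.exp (-(R * (ex t i - ex t (k j))))) atTop (𝓝 0) :=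
        Real.tendsto_exp_neg_atTop_nhds_zero.comp (tendsto_id.atTop_mul_const hpos)
      simpa using h1.mul_const (dl (a j) i)
    · subst hi
      rw [if_pos rfl, h.dl_k]
      have : ∀ R, tau R t (k j) / tau R t (k j) = 1 := fun R => div_self (tau_pos _ _ _).ne'
      simp only [this, one_mul]
      exact tendsto_const_nhds
    · rw [if_neg hi.ne', h.dl_zero j i hi]; simp
  have hsum : Tendsto (fun R => ∑ i, (tau R t i / tau R t (k j)) * dl (a j) i) atTop
      (𝓝 (a j (k j))) := by
    have := tendsto_finsetSum Finset.univ (fun i _ => hterm i)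
    simpa using this
  have hq := (hterm i).div hsum hak.ne'
  have e1 : (if i = k j then a j (k j) else 0) / a j (k j) = if i = k j then 1 else 0 := by
    split_ifs
    · exact div_self hak.ne'
    · simp
  rw [e1] at hq
  refine hq.congr fun R => ?_
  have hτ := (tau_pos R t (k j)).ne'
  have e2 : ∀ i, tau R t i / tau R t (k j) * dl (a j) i =
      (tau R t (k j))⁻¹ * (tau R t i * dl (a j) i) := fun i => by
    rw [div_eq_inv_mul]; ring
  simp only [Pi.div_apply, e2]
  rw [← Finset.mul_sum, mul_div_mul_left _ _ (inv_ne_zero hτ)]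

theorem al_eq (R : ℝ) (t w : Euc d) (j : ι) :
    al (fun j => dl (a j)) R t w j =
      ∑ i, ex w i * ((tau R t i * dl (a j) i) / (∑ i, tau R t i * dl (a j) i)) := by
  rw [al, Finset.sum_div]
  exact Finset.sum_congr rfl fun i _ => by rw [mul_div_assoc]

theorem tendsto_al (h : FlagData a k) {t : Euc d} (ht : StrictAnti (ex t)) (j : ι) (w : Euc d) :
    Tendsto (fun R => al (fun j => dl (a j)) R t w j) atTop (𝓝 (ex w (k j))) := by
  simp only [al_eq]
  have := tendsto_finsetSum Finset.univ (fun i _ => (h.tendsto_coef ht j i).const_mul (ex w i))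
  simpa using this

theorem al_close [Finite ι] (h : FlagData a k) {t : Euc d} (ht : StrictAnti (ex t)) {ε : ℝ}
    (hε : 0 < ε) : ∀ᶠ R in atTop, ∀ j, ∀ w : Euc d, ∀ c : ℝ, (∀ i, |ex w i| ≤ c) →
      |al (fun j => dl (a j)) R t w j - ex w (k j)| ≤ ε * c := by
  rw [eventually_all]
  intro j
  have hlim : Tendsto (fun R => ∑ i, |(tau R t i * dl (a j) i) / (∑ i, tau R t i * dl (a j) i) -
      if i = k j then 1 else 0|) atTop (𝓝 0) := by
    have := tendsto_finsetSum Finset.univ (fun i _ =>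
      ((h.tendsto_coef ht j i).sub_const (if i = k j then 1 else 0)).abs)
    simpa using this
  filter_upwards [hlim.eventually (gt_mem_nhds hε)] with R hR w c hw
  have hc : 0 ≤ c := (abs_nonneg _).trans (hw 0)
  have e : al (fun j => dl (a j)) R t w j - ex w (k j) = ∑ i, ex w i *
      ((tau R t i * dl (a j) i) / (∑ i, tau R t i * dl (a j) i) - if i = k j then 1 else 0) := by
    rw [al_eq]
    simp only [mul_sub, Finset.sum_sub_distrib]
    simp
  rw [e]
  refine (Finset.abs_sum_le_sum_abs _ _).trans ?_
  calc _ ≤ ∑ i, c * |(tau R t i * dl (a j) i) / (∑ i, tau R t i * dl (a j) i) -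
        if i = k j then 1 else 0| := Finset.sum_le_sum fun i _ => by
          rw [abs_mul]; exact mul_le_mul_of_nonneg_right (hw i) (abs_nonneg _)
    _ ≤ c * ε := by
        rw [← Finset.mul_sum]; exact mul_le_mul_of_nonneg_left hR.le hc
    _ = ε * c := mul_comm _ _

end FlagData

theorem continuous_al {d : ℕ} {ι : Type} (δ : ι → Fin (d + 1) → ℝ) (R : ℝ) (t : Euc d) (j : ι) :
    Continuous (fun w => al δ R t w j) := by
  unfold al
  refine Continuous.div_const ?_ _
  exact continuous_finsetSum _ fun i _ => (continuous_ex i).mul continuous_const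

theorem measurableSet_Bt {d : ℕ} {ι : Type} [Finite ι] (δ : ι → Fin (d + 1) → ℝ) (R : ℝ)
    (t : Euc d) : MeasurableSet (Bt δ R t) := by
  have : Bt δ R t = ⋂ i, ⋂ j, {w | al δ R t w i - al δ R t w j < 2} := by ext; simp [Bt]
  rw [this]
  exact (isOpen_iInter_of_finite fun i => isOpen_iInter_of_finite fun j =>
    isOpen_lt ((continuous_al δ R t i).sub (continuous_al δ R t j)) continuous_const).measurableSet

theorem measurableSet_Nb (d : ℕ) : MeasurableSet (Nb d) := by
  have : Nb d = ⋂ i, ⋂ j, {w | ex w i - ex w j < 2} := by ext; simp [Nb]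
  rw [this]
  exact (isOpen_iInter_of_finite fun i => isOpen_iInter_of_finite fun j =>
    isOpen_lt ((continuous_ex i).sub (continuous_ex j)) continuous_const).measurableSet

/-- A cube. -/
def cube (d : ℕ) (c : ℝ) : Set (Euc d) := {w | ∀ i, |ex w i| ≤ c}

theorem measurableSet_cube (d : ℕ) (c : ℝ) : MeasurableSet (cube d c) := by
  have : cube d c = ⋂ i, {w | |ex w i| ≤ c} := by ext; simp [cube]
  rw [this]
  exact (isClosed_iInter fun i => isClosed_le (continuous_ex i).abs continuous_const).measurableSet

theorem volume_cube_lt_top (d : ℕ) (c : ℝ) : volume (cube d c) ≠ ⊤ := by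
  have hsub : cube d c ⊆ Metric.closedBall 0 (Real.sqrt (∑ _i : Fin d, c ^ 2)) := by
    intro w hw
    rw [mem_closedBall_zero_iff, EuclideanSpace.norm_eq]
    apply Real.sqrt_le_sqrt
    refine Finset.sum_le_sum fun i _ => ?_
    have := hw i.castSucc
    rw [ex_castSucc] at this
    rw [Real.norm_eq_abs]
    exact pow_le_pow_left₀ (abs_nonneg _) this 2
  exact ne_top_of_le_ne_top (measure_closedBall_lt_top.ne) (measure_mono hsub)

theorem FlagData.tendsto_volume {d : ℕ} {ι : Type} [Finite ι] {a : ι → Fin (d + 1) → ℝ}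
    {k : ι → Fin (d + 1)} (h : FlagData a k) {t : Euc d} (ht : StrictAnti (ex t)) :
    Tendsto (fun R => volume (Bt (fun j => dl (a j)) R t)) atTop (𝓝 (volume (Nb d))) := by
  refine tendsto_measure_of_ae_tendsto_indicator atTop (measurableSet_Nb d)
    (fun R => measurableSet_Bt _ R t) (measurableSet_cube d 4) (volume_cube_lt_top d 4) ?_ ?_
  · filter_upwards [h.al_close ht (ε := 1 / 4) (by norm_num)] with R hR w hw
    obtain ⟨i0, hi0⟩ := Finite.exists_max (fun i => |ex w i|)
    obtain ⟨j0, hj0⟩ := h.surj i0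
    obtain ⟨j1, hj1⟩ := h.surj (Fin.last d)
    have c0 := hR j0 w _ hi0
    have c1 := hR j1 w _ hi0
    rw [hj0] at c0
    rw [hj1, ex_last, sub_zero] at c1
    have b0 := hw j0 j1
    have b1 := hw j1 j0
    have key : |ex w i0| ≤ 4 := by
      rw [abs_le] at c0 c1
      rcases abs_cases (ex w i0) with ⟨e, _⟩ | ⟨e, _⟩ <;> rw [e] at c0 c1 ⊢ <;> linarith
    exact fun i => (hi0 i).trans key
  · have hae : ∀ᵐ w : Euc d, ∀ i j : Fin (d + 1), i ≠ j → ex w i - ex w j ≠ 2 := by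
      rw [ae_all_iff]; intro i
      rw [ae_all_iff]; intro j
      by_cases hij : i = j
      · exact Eventually.of_forall fun w hw => absurd hij hw
      · have := measure_hyperplane (exL i - exL j) (exL_sub_ne hij) 2
        rw [measure_eq_zero_iff_ae_notMem] at this
        filter_upwards [this] with w hw _ hh
        exact hw hh
    filter_upwards [hae] with w hw
    by_cases hN : w ∈ Nb d
    · have : ∀ᶠ R in atTop, ∀ i j, al (fun j => dl (a j)) R t w i -
          al (fun j => dl (a j)) R t w j < 2 := by
        rw [eventually_all]; intro i
        rw [eventually_all]; intro j
        exact ((h.tendsto_al ht i w).sub (h.tendsto_al ht j w)).eventually (gt_mem_nhds (hN _ _))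
      filter_upwards [this] with R hR
      exact ⟨fun _ => hN, fun _ => hR⟩
    · have hN' := hN
      simp only [Nb, Set.mem_ofPred_eq, not_forall, not_lt] at hN'
      obtain ⟨i, j, hij⟩ := hN'
      have hne : i ≠ j := by rintro rfl; rw [sub_self] at hij; norm_num at hij
      have hlt : 2 < ex w i - ex w j := lt_of_le_of_ne hij (Ne.symm (hw i j hne))
      obtain ⟨i', rfl⟩ := h.surj i
      obtain ⟨j', rfl⟩ := h.surj j
      filter_upwards [((h.tendsto_al ht i' w).sub (h.tendsto_al ht j' w)).eventually
        (lt_mem_nhds hlt)] with R hR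
      exact ⟨fun hB => absurd (hB i' j') (not_lt.2 hR.le), fun hh => absurd hh hN⟩

theorem FlagData.ball_subset {d : ℕ} {ι : Type} [Fintype ι] {a : ι → Fin (d + 1) → ℝ}
    {k : ι → Fin (d + 1)} (h : FlagData a k) : ∃ r : ℝ, 0 < r ∧ ∀ R, 0 ≤ R → ∀ t : Euc d,
      StrictAnti (ex t) → Metric.ball 0 r ⊆ Bt (fun j => dl (a j)) R t := by
  obtain ⟨m, hm0, hm⟩ := h.exists_lower
  set K : ℝ := ∑ j, ∑ i, |dl (a j) i| with hK
  have hK0 : 0 ≤ K := by positivity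
  refine ⟨m / (K + 1), by positivity, fun R hR t ht w hw => ?_⟩
  have habs : ∀ j, |al (fun j => dl (a j)) R t w j| < 1 := by
    intro j
    have hpos := tau_pos R t
    have hlow := h.sum_lower hm hpos (tau_mono hR ht) j
    have hup := h.abs_sum_le hpos (tau_mono hR ht) j (ex w) (abs_ex_le w)
    have hden : 0 < ∑ i, tau R t i * dl (a j) i := lt_of_lt_of_le (mul_pos hm0 (hpos _)) hlow
    rw [al, abs_div, abs_of_pos hden, div_lt_one hden]
    refine lt_of_le_of_lt hup (lt_of_lt_of_le ?_ hlow)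
    apply mul_lt_mul_of_pos_right _ (hpos _)
    have h1 : ∑ i, |dl (a j) i| ≤ K := by
      rw [hK]
      exact Finset.single_le_sum (f := fun j => ∑ i, |dl (a j) i|)
        (fun j _ => by positivity) (Finset.mem_univ j)
    have h2 : ‖w‖ < m / (K + 1) := by simpa using hw
    rw [lt_div_iff₀ (by positivity)] at h2
    have h3 := mul_le_mul_of_nonneg_left h1 (norm_nonneg w)
    nlinarith [norm_nonneg w]
  intro i j
  have h1 := abs_lt.1 (habs i)
  have h2 := abs_lt.1 (habs j)
  show al _ R t w i - al _ R t w j < 2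
  linarith

/-! ### Analysis in one flag simplex: the change of variables -/

/-- The linear functional `ex · i` as a continuous linear map. -/
def exC {d : ℕ} (i : Fin (d + 1)) : Euc d →L[ℝ] ℝ := LinearMap.toContinuousLinearMap (exL i)

@[simp] theorem exC_apply {d : ℕ} (i : Fin (d + 1)) (w : Euc d) : exC i w = ex w i := rfl

/-- The parameter domain. -/
def Wd (d : ℕ) : Set (Euc d) := {t | StrictAnti (ex t)}

theorem isOpen_Wd (d : ℕ) : IsOpen (Wd d) := by
  have : Wd d = ⋂ i : Fin (d + 1), ⋂ j : Fin (d + 1), ⋂ _ : i < j, {t | ex t j < ex t i} := by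
    ext t
    simp only [Wd, Set.mem_ofPred_eq, Set.mem_iInter]
    exact ⟨fun h i j hij => h hij, fun h i j hij => h i j hij⟩
  rw [this]
  exact isOpen_iInter_of_finite fun i => isOpen_iInter_of_finite fun j =>
    isOpen_iInter_of_finite fun _ => isOpen_lt (continuous_ex j) (continuous_ex i)

/-- The parametrization of the open simplex. -/
def TT {d : ℕ} (v : Fin (d + 1) → Euc d) (R : ℝ) (t : Euc d) : Euc d := ∑ i, tau R t i • dl v i

/-- The derivative of the parametrization. -/
def DTT {d : ℕ} (v : Fin (d + 1) → Euc d) (R : ℝ) (t : Euc d) : Euc d →L[ℝ] Euc d :=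
  ∑ i, (tau R t i • (-R) • exC i).smulRight (dl v i)

theorem DTT_apply {d : ℕ} (v : Fin (d + 1) → Euc d) (R : ℝ) (t w : Euc d) :
    DTT v R t w = ∑ i, (tau R t i * (-R * ex w i)) • dl v i := by
  simp [DTT]

theorem hasFDerivAt_tau {d : ℕ} (R : ℝ) (t : Euc d) (i : Fin (d + 1)) :
    HasFDerivAt (fun t => tau R t i) (tau R t i • (-R) • exC i) t := by
  have h : HasFDerivAt (fun t : Euc d => -R * ex t i) ((-R) • exC i) t :=
    ((exC i).hasFDerivAt (x := t)).const_mul (-R)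
  have h2 := h.exp
  have e : ∀ t : Euc d, tau R t i = Real.exp (-R * ex t i) := fun t => by
    rw [tau, neg_mul]
  simpa only [e] using h2

theorem continuous_tau {d : ℕ} (R : ℝ) (i : Fin (d + 1)) : Continuous (fun t : Euc d => tau R t i) :=
  continuous_iff_continuousAt.2 fun t => (hasFDerivAt_tau R t i).continuousAt

theorem hasFDerivAt_TT {d : ℕ} (v : Fin (d + 1) → Euc d) (R : ℝ) (t : Euc d) :
    HasFDerivAt (TT v R) (DTT v R t) t := by
  have := HasFDerivAt.fun_sum (u := Finset.univ)
    (fun i _ => (hasFDerivAt_tau R t i).smul_const (dl v i))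
  exact this

theorem continuous_TT {d : ℕ} (v : Fin (d + 1) → Euc d) (R : ℝ) : Continuous (TT v R) :=
  continuous_iff_continuousAt.2 fun t => (hasFDerivAt_TT v R t).continuousAt

theorem FlagData.tri {d : ℕ} {ι : Type} {a : ι → Fin (d + 1) → ℝ}
    {k : ι → Fin (d + 1)} (h : FlagData a k) {σ : Fin (d + 1) → ℝ}
    (hσ : ∀ j, ∑ i, σ i * dl (a j) i = 0) (i : Fin (d + 1)) : σ i = 0 := by
  induction i using WellFoundedLT.induction with
  | _ i ih =>
    obtain ⟨j, hj⟩ := h.surj i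
    have h1 := hσ j
    rw [Finset.sum_eq_single i] at h1
    · have h2 := h.dl_k j
      have h3 := h.pos j (k j) le_rfl
      rw [hj] at h2 h3
      rw [h2] at h1
      exact (mul_eq_zero.1 h1).resolve_right h3.ne'
    · intro m _ hm
      rcases lt_or_gt_of_ne hm with hlt | hgt
      · rw [ih m hlt, zero_mul]
      · rw [h.dl_zero j m (by rw [hj]; exact hgt), mul_zero]
    · simp

/-- The open simplex. -/
def Sx {d : ℕ} (v : Fin (d + 1) → Euc d) : Set (Euc d) :=
  {x | ∃ μ : Fin (d + 1) → ℝ, (∀ i, 0 < μ i) ∧ ∑ i, μ i = 1 ∧ x = ∑ i, μ i • v i}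

theorem image_TT {d : ℕ} (v : Fin (d + 1) → Euc d) {R : ℝ} (hR : 0 < R) :
    TT v R '' Wd d = Sx v := by
  ext x
  constructor
  · rintro ⟨t, ht, rfl⟩
    have ht : StrictAnti (ex t) := ht
    refine ⟨Fin.cases (tau R t 0) (fun i => tau R t i.succ - tau R t i.castSucc), ?_, ?_, ?_⟩
    · intro i
      refine Fin.cases ?_ (fun i => ?_) i
      · exact tau_pos _ _ _
      · simp only [Fin.cases_succ, sub_pos]
        apply Real.exp_lt_exp.2
        have := mul_lt_mul_of_pos_left (ht (Fin.castSucc_lt_succ (i := i))) hR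
        linarith
    · have := dl_abel (fun _ : Fin (d + 1) => (1 : ℝ)) (tau R t)
      rw [Fin.sum_univ_castSucc] at this
      simp only [dl_castSucc, dl_last, sub_self, mul_zero, Finset.sum_const_zero, zero_add,
        tau_last, smul_eq_mul, mul_one] at this
      rw [Fin.sum_univ_succ]
      simp only [Fin.cases_zero, Fin.cases_succ]
      exact this.symm
    · rw [TT, dl_abel, Fin.sum_univ_succ]
      simp only [Fin.cases_zero, Fin.cases_succ]
  · rintro ⟨μ, hμ, hs, rfl⟩
    set τ : Fin (d + 1) → ℝ := fun i => ∑ m ∈ Finset.Iic i, μ m with hτ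
    have hpos : ∀ i, 0 < τ i := fun i => Finset.sum_pos (fun m _ => hμ m) ⟨i, by simp⟩
    have hlast : τ (Fin.last d) = 1 := by
      rw [hτ]; simp only
      rw [← hs]; congr 1; ext i; simp [Fin.le_last]
    have h0 : τ 0 = μ 0 := by
      have : Finset.Iic (0 : Fin (d + 1)) = {0} := by ext i; simp
      rw [hτ]; simp only
      rw [this, Finset.sum_singleton]
    have hsucc : ∀ i : Fin d, τ i.succ - τ i.castSucc = μ i.succ := by
      intro i
      have : Finset.Iic i.succ = insert i.succ (Finset.Iic i.castSucc) := by
        ext m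
        simp only [Finset.mem_Iic, Finset.mem_insert]
        rw [le_iff_eq_or_lt, ← Fin.le_castSucc_iff]
      rw [hτ]; simp only
      rw [this, Finset.sum_insert (by simp)]; ring
    have hmono : StrictMono τ := by
      refine Fin.strictMono_iff_lt_succ.2 fun i => ?_
      have := hsucc i; have := hμ i.succ; linarith
    let t : Euc d := WithLp.toLp 2 fun i : Fin d => -(Real.log (τ i.castSucc)) / R
    have hex : ∀ i, ex t i = -(Real.log (τ i)) / R := by
      intro i
      refine Fin.lastCases ?_ (fun i => ?_) i
      · rw [ex_last, hlast]; simp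
      · rw [ex_castSucc]
    have htau : ∀ i, tau R t i = τ i := by
      intro i
      rw [tau, hex, mul_div_cancel₀ _ hR.ne', neg_neg, Real.exp_log (hpos i)]
    refine ⟨t, ?_, ?_⟩
    · intro i j hij
      rw [hex, hex]
      have := Real.log_lt_log (hpos i) (hmono hij)
      apply div_lt_div_of_pos_right _ hR
      linarith
    · rw [TT, dl_abel, Fin.sum_univ_succ]
      simp only [htau, h0, hsucc]

namespace HRep

variable {d : ℕ} {ι : Type} {P : Set (Euc d)}

theorem g_dl (H : HRep ι P) (v : Fin (d + 1) → Euc d) (j : ι) (σ : Fin (d + 1) → ℝ)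
    (hσ : σ (Fin.last d) = 0) :
    H.g j (∑ i, σ i • dl v i) = ∑ i, σ i * dl (fun i => H.l j (v i)) i := by
  rw [map_sum, Fin.sum_univ_castSucc, Fin.sum_univ_castSucc, hσ]
  simp [g_sub]

theorem l_dl (H : HRep ι P) (v : Fin (d + 1) → Euc d) (j : ι) (σ : Fin (d + 1) → ℝ)
    (hσ : σ (Fin.last d) = 1) :
    H.l j (∑ i, σ i • dl v i) = ∑ i, σ i * dl (fun i => H.l j (v i)) i := by
  rw [l, map_sum, Fin.sum_univ_castSucc, Fin.sum_univ_castSucc, hσ]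
  simp only [map_smul, dl_castSucc, g_sub, dl_last, one_smul, smul_eq_mul, one_mul]
  rw [l]; ring

theorem l_TT (H : HRep ι P) (v : Fin (d + 1) → Euc d) (R : ℝ) (t : Euc d) (j : ι) :
    H.l j (TT v R t) = ∑ i, tau R t i * dl (fun i => H.l j (v i)) i :=
  H.l_dl v j _ (tau_last R t)

variable (H : HRep ι P) {v : Fin (d + 1) → Euc d} {k : ι → Fin (d + 1)}

theorem TT_mem_int [Finite ι] (h : FlagData (fun j i => H.l j (v i)) k) {R : ℝ} (hR : 0 ≤ R) {t : Euc d}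
    (ht : t ∈ Wd d) : TT v R t ∈ interior P := by
  rw [H.int']
  intro j
  rw [l_TT]
  obtain ⟨m, hm0, hm⟩ := h.exists_lower
  exact (mul_pos hm0 (tau_pos R t (k j))).trans_le
    (h.sum_lower hm (tau_pos R t) (tau_mono hR ht) j)

theorem TT_inj (h : FlagData (fun j i => H.l j (v i)) k) {R : ℝ} (hR : 0 < R) :
    Function.Injective (TT v R) := by
  intro s t hst
  have h0 : ∀ i, tau R s i - tau R t i = 0 := by
    apply h.tri
    intro j
    rw [← H.g_dl v j _ (by simp)]
    simp only [sub_smul, Finset.sum_sub_distrib]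
    have : ∑ i, tau R s i • dl v i = ∑ i, tau R t i • dl v i := hst
    rw [this, sub_self, map_zero]
  ext i
  have := sub_eq_zero.1 (h0 i.castSucc)
  simp only [tau_castSucc, Real.exp_eq_exp, neg_inj] at this
  exact mul_left_cancel₀ hR.ne' this

theorem DTT_det_ne (h : FlagData (fun j i => H.l j (v i)) k) {R : ℝ} (hR : 0 < R) (t : Euc d) :
    (DTT v R t).det ≠ 0 := by
  have hk : LinearMap.ker (DTT v R t : Euc d →ₗ[ℝ] Euc d) = ⊥ := by
    rw [LinearMap.ker_eq_bot']
    intro w hw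
    have h0 : ∀ i, tau R t i * (-R * ex w i) = 0 := by
      apply h.tri
      intro j
      rw [← H.g_dl v j _ (by simp)]
      have : ∑ i, (tau R t i * (-R * ex w i)) • dl v i = 0 := by rw [← DTT_apply]; exact hw
      rw [this, map_zero]
    ext i
    have := h0 i.castSucc
    have h1 := (tau_pos R t i.castSucc).ne'
    simpa [h1, hR.ne'] using this
  intro hdet
  have := LinearMap.bot_lt_ker_of_det_eq_zero (f := (DTT v R t : Euc d →ₗ[ℝ] Euc d)) hdet
  rw [hk] at this
  exact lt_irrefl _ this

theorem preimage_beta [Fintype ι] [Nonempty ι] (h : FlagData (fun j i => H.l j (v i)) k) {R : ℝ}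
    (hR : 0 < R) {t : Euc d} (ht : t ∈ Wd d) :
    DTT v R t ⁻¹' finslerUnitBall (interior P) (TT v R t) =
      (fun w => (-R) • w) ⁻¹' Bt (fun j => dl (fun i => H.l j (v i))) R t := by
  ext w
  simp only [Set.mem_preimage, finslerUnitBall, Set.mem_ofPred_eq, Bt]
  rw [H.finsler_lt_one (H.TT_mem_int h hR.le ht)]
  have : ∀ j, H.g j (DTT v R t w) / H.l j (TT v R t) =
      al (fun j => dl (fun i => H.l j (v i))) R t ((-R) • w) j := by
    intro j
    rw [DTT_apply, H.g_dl v j _ (by simp), l_TT, al]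
    congr 1
    refine Finset.sum_congr rfl fun i _ => ?_
    rw [ex_smul]; ring
  simp only [this]

theorem density_eq [Fintype ι] [Nonempty ι] (h : FlagData (fun j i => H.l j (v i)) k) {R : ℝ}
    (hR : 0 < R) {t : Euc d} (ht : t ∈ Wd d) (ω : ℝ≥0∞) :
    ENNReal.ofReal |(DTT v R t).det| * (ω / volume (finslerUnitBall (interior P) (TT v R t))) =
      ENNReal.ofReal (R ^ d) * (ω / volume (Bt (fun j => dl (fun i => H.l j (v i))) R t)) := by
  have hdet := H.DTT_det_ne h hR t
  have h1 := congrArg volume (H.preimage_beta h hR ht)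
  rw [Measure.addHaar_preimage_continuousLinearMap _ hdet,
    Measure.addHaar_preimage_smul _ (neg_ne_zero.2 hR.ne')] at h1
  have e1 : |((-R) ^ Module.finrank ℝ (Euc d))⁻¹| = (R ^ d)⁻¹ := by
    rw [abs_inv, abs_pow, abs_neg, abs_of_pos hR]; simp
  rw [e1, abs_inv, ENNReal.ofReal_inv_of_pos (abs_pos.2 hdet),
    ENNReal.ofReal_inv_of_pos (by positivity)] at h1
  set D := ENNReal.ofReal |(DTT v R t).det|
  have hD0 : D ≠ 0 := by simpa [D] using hdet
  set r := ENNReal.ofReal (R ^ d)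
  have hr0 : r ≠ 0 := by
    have : 0 < R ^ d := by positivity
    simpa [r] using this
  have key : ∀ (D : ℝ≥0∞), D ≠ 0 → D ≠ ⊤ → ∀ x, D * (ω / x) = ω * (D⁻¹ * x)⁻¹ := by
    intro D h0 ht x
    rw [ENNReal.mul_inv (Or.inl (by simpa using ht)) (Or.inl (by simpa using h0)), inv_inv,
      div_eq_mul_inv]
    ring
  rw [key D hD0 ENNReal.ofReal_ne_top, key r hr0 ENNReal.ofReal_ne_top, h1]

theorem lintegral_flag [Fintype ι] [Nonempty ι] (h : FlagData (fun j i => H.l j (v i)) k) {R : ℝ}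
    (hR : 0 < R) {B : Set (Euc d)} (hB : MeasurableSet B) (ω : ℝ≥0∞) :
    ∫⁻ x in Sx v ∩ B, ω / volume (finslerUnitBall (interior P) x) =
      ENNReal.ofReal (R ^ d) * ∫⁻ t in Wd d ∩ TT v R ⁻¹' B,
        ω / volume (Bt (fun j => dl (fun i => H.l j (v i))) R t) := by
  have hm : MeasurableSet (Wd d ∩ TT v R ⁻¹' B) :=
    (isOpen_Wd d).measurableSet.inter ((continuous_TT v R).measurable hB)
  rw [← image_TT v hR, ← Set.image_inter_preimage,
    lintegral_image_eq_lintegral_abs_det_fderiv_mul volume hm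
      (fun t _ => (hasFDerivAt_TT v R t).hasFDerivWithinAt) (H.TT_inj h hR).injOn,
    ← lintegral_const_mul' _ _ ENNReal.ofReal_ne_top]
  exact setLIntegral_congr_fun hm fun t ht => H.density_eq h hR ht.1 ω

theorem measurableSet_Sx (v : Fin (d + 1) → Euc d) (H : HRep ι P) 
    (h : FlagData (fun j i => H.l j (v i)) k) : MeasurableSet (Sx v) := by
  rw [← image_TT v one_pos]
  exact measurable_image_of_fderivWithin (isOpen_Wd d).measurableSet
      (fun t _ => (hasFDerivAt_TT v 1 t).hasFDerivWithinAt) (H.TT_inj h one_pos).injOn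

end HRep

/-! ### Analysis in one flag simplex: the limit -/

/-- The limiting contribution of one flag. -/
def limC (d : ℕ) : ℝ≥0∞ :=
  ∫⁻ t, (Wd d ∩ {t : Euc d | ex t 0 < 2}).indicator
    (fun _ => volume (ball (0 : Euc d) 1) / volume (Nb d)) t

theorem measurable_vol_Bt {d : ℕ} {ι : Type} [Finite ι] (δ : ι → Fin (d + 1) → ℝ) (R : ℝ) :
    Measurable (fun t : Euc d => volume (Bt δ R t)) := by
  have hal : ∀ j, Measurable (fun q : Euc d × Euc d => al δ R q.1 q.2 j) := by
    intro j
    unfold al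
    have h1 : ∀ i, Continuous (fun q : Euc d × Euc d => tau R q.1 i) := fun i =>
      (continuous_tau R i).comp continuous_fst
    have h2 : ∀ i, Continuous (fun q : Euc d × Euc d => ex q.2 i) := fun i =>
      (continuous_ex i).comp continuous_snd
    refine Measurable.div ?_ ?_
    · exact (continuous_finsetSum _ fun i _ =>
        (h2 i).mul ((h1 i).mul continuous_const)).measurable
    · exact (continuous_finsetSum _ fun i _ => (h1 i).mul continuous_const).measurable
  have hs : MeasurableSet {q : Euc d × Euc d | ∀ i j, al δ R q.1 q.2 i - al δ R q.1 q.2 j < 2} := by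
    have : {q : Euc d × Euc d | ∀ i j, al δ R q.1 q.2 i - al δ R q.1 q.2 j < 2} =
        ⋂ i, ⋂ j, {q : Euc d × Euc d | al δ R q.1 q.2 i - al δ R q.1 q.2 j < 2} := by
      ext; simp
    rw [this]
    exact MeasurableSet.iInter fun i => MeasurableSet.iInter fun j =>
      measurableSet_lt ((hal i).sub (hal j)) measurable_const
  exact measurable_measure_prodMk_left hs

namespace HRep

variable {d : ℕ} {ι : Type} {P : Set (Euc d)}

theorem mem_ball_iff (H : HRep ι P) [Fintype ι] [Nonempty ι] {p q : Euc d} (hp : p ∈ interior P)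
    (hq : q ∈ interior P) (R : ℝ) : q ∈ hilbertBall (interior P) p R ↔
      ∀ i j, H.l i q * H.l j p ≤ Real.exp (2 * R) * (H.l i p * H.l j q) := by
  rw [← H.hilbert_le hp hq]
  simp [hilbertBall, hq]

theorem measurableSet_hilbertBall (H : HRep ι P) [Fintype ι] [Nonempty ι] {p : Euc d}
    (hp : p ∈ interior P) (R : ℝ) : MeasurableSet (hilbertBall (interior P) p R) := by
  have : hilbertBall (interior P) p R = interior P ∩ ⋂ i, ⋂ j,
      {q | H.l i q * H.l j p ≤ Real.exp (2 * R) * (H.l i p * H.l j q)} := by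
    ext q
    constructor
    · intro h
      refine ⟨h.1, ?_⟩
      simpa using (H.mem_ball_iff hp h.1 R).1 h
    · rintro ⟨h1, h2⟩
      rw [H.mem_ball_iff hp h1]
      simpa using h2
  rw [this]
  refine isOpen_interior.measurableSet.inter (IsClosed.measurableSet ?_)
  exact isClosed_iInter fun i => isClosed_iInter fun j => isClosed_le
    ((H.continuous_l i).mul continuous_const)
    (continuous_const.mul (continuous_const.mul (H.continuous_l j)))

variable (H : HRep ι P) {v : Fin (d + 1) → Euc d} {k : ι → Fin (d + 1)}

theorem ball_bounds [Fintype ι] [Nonempty ι] (h : FlagData (fun j i => H.l j (v i)) k)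
    {p : Euc d} (hp : p ∈ interior P) : ∃ A A' : ℝ, 0 < A ∧ 0 < A' ∧ ∀ R, 0 ≤ R → ∀ t ∈ Wd d,
      (A' ≤ Real.exp (R * (2 - ex t 0)) → TT v R t ∈ hilbertBall (interior P) p R) ∧
      (TT v R t ∈ hilbertBall (interior P) p R → A ≤ Real.exp (R * (2 - ex t 0))) := by
  obtain ⟨m, hm0, hm⟩ := h.exists_lower
  have hlp := (H.int' p).1 hp
  obtain ⟨jm, hjm⟩ := Finite.exists_min (fun j => H.l j p)
  obtain ⟨jM, hjM⟩ := Finite.exists_max (fun j => H.l j p)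
  set c0 := H.l jm p
  set C0 := H.l jM p
  have hc0 : 0 < c0 := hlp jm
  have hC0 : 0 < C0 := hlp jM
  set K : ℝ := 1 + ∑ j, ∑ i, |dl (fun i => H.l j (v i)) i| with hK
  have hK0 : 0 < K := by positivity
  refine ⟨m * c0 / (C0 * K), K * C0 / (c0 * m), by positivity, by positivity, ?_⟩
  intro R hR t ht
  have ht' : StrictAnti (ex t) := ht
  have hmon := tau_mono hR ht'
  have hlow : ∀ j, m * tau R t (k j) ≤ H.l j (TT v R t) := by
    intro j; rw [l_TT]; exact h.sum_lower hm (tau_pos R t) hmon j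
  have hup : ∀ j, H.l j (TT v R t) ≤ K * tau R t (k j) := by
    intro j; rw [l_TT]
    have h1 := h.abs_sum_le (tau_pos R t) hmon j (fun _ => 1) (c := 1) (by simp)
    simp only [one_mul] at h1
    refine (le_abs_self _).trans (h1.trans ?_)
    refine mul_le_mul_of_nonneg_right ?_ (tau_pos R t _).le
    have := Finset.single_le_sum (f := fun j => ∑ i, |dl (fun i => H.l j (v i)) i|)
      (fun j _ => by positivity) (Finset.mem_univ j)
    linarith
  have htau1 : ∀ i, tau R t i ≤ 1 := fun i => by
    have := hmon (Fin.le_last i); rwa [tau_last] at this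
  have htau0 : ∀ i, tau R t 0 ≤ tau R t i := fun i => hmon (Fin.zero_le i)
  have hexp : Real.exp (R * (2 - ex t 0)) = Real.exp (2 * R) * tau R t 0 := by
    rw [tau, ← Real.exp_add]; congr 1; ring
  have hlpos : ∀ j, 0 < H.l j (TT v R t) := fun j =>
    (mul_pos hm0 (tau_pos R t (k j))).trans_le (hlow j)
  rw [H.mem_ball_iff hp (H.TT_mem_int h hR ht), hexp]
  have he := Real.exp_pos (2 * R)
  constructor
  · intro hA i j
    rw [div_le_iff₀ (by positivity)] at hA
    have h1 : H.l i (TT v R t) * H.l j p ≤ K * C0 := by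
      refine mul_le_mul ((hup i).trans ?_) (hjM j) (hlp j).le hK0.le
      have := mul_le_mul_of_nonneg_left (htau1 (k i)) hK0.le
      linarith
    have h2 : c0 * (m * tau R t 0) ≤ H.l i p * H.l j (TT v R t) := by
      refine mul_le_mul (hjm i) (le_trans ?_ (hlow j)) (mul_pos hm0 (tau_pos R t 0)).le (hlp i).le
      exact mul_le_mul_of_nonneg_left (htau0 _) hm0.le
    have h3 := mul_le_mul_of_nonneg_left h2 he.le
    nlinarith
  · intro hB
    obtain ⟨i, hi⟩ := h.surj (Fin.last d)
    obtain ⟨j, hj⟩ := h.surj 0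
    have h0 := hB i j
    rw [div_le_iff₀ (by positivity)]
    have h1 : m * c0 ≤ H.l i (TT v R t) * H.l j p := by
      refine mul_le_mul ?_ (hjm j) hc0.le (hlpos i).le
      have := hlow i
      rwa [hi, tau_last, mul_one] at this
    have h2 : H.l i p * H.l j (TT v R t) ≤ C0 * (K * tau R t 0) := by
      refine mul_le_mul (hjM i) ?_ (hlpos j).le hC0.le
      have := hup j
      rwa [hj] at this
    have h3 := mul_le_mul_of_nonneg_left h2 he.le
    nlinarith

theorem tendsto_flag [Fintype ι] [Nonempty ι] (hd : 0 < d)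
    (h : FlagData (fun j i => H.l j (v i)) k) {p : Euc d} (hp : p ∈ interior P) :
    Tendsto (fun R : ℝ => (∫⁻ x in Sx v ∩ hilbertBall (interior P) p R,
        volume (ball (0 : Euc d) 1) / volume (finslerUnitBall (interior P) x)) /
          ENNReal.ofReal (R ^ d)) atTop (𝓝 (limC d)) := by
  set ω := volume (ball (0 : Euc d) 1) with hω
  have hωt : ω ≠ ⊤ := measure_ball_lt_top.ne
  set δ : ι → Fin (d + 1) → ℝ := fun j => dl (fun i => H.l j (v i)) with hδ
  set D : ℝ → Set (Euc d) := fun R => Wd d ∩ TT v R ⁻¹' hilbertBall (interior P) p R with hD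
  have hDm : ∀ R, MeasurableSet (D R) := fun R =>
    (isOpen_Wd d).measurableSet.inter
      ((continuous_TT v R).measurable (H.measurableSet_hilbertBall hp R))
  obtain ⟨A, A', hA, hA', hball⟩ := H.ball_bounds h hp
  obtain ⟨r, hr, hrsub⟩ := h.ball_subset
  have hmain : Tendsto (fun R : ℝ => ∫⁻ t, (D R).indicator (fun t => ω / volume (Bt δ R t)) t)
      atTop (𝓝 (limC d)) := by
    refine tendsto_lintegral_filter_of_dominated_convergence
      ((cube d (2 + |Real.log A|)).indicator (fun _ => ω / volume (ball (0 : Euc d) r))) ?_ ?_ ?_ ?_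
    · exact Eventually.of_forall fun R =>
        (Measurable.const_div (measurable_vol_Bt δ R) ω).indicator (hDm R)
    · filter_upwards [eventually_ge_atTop 1] with R hR
      refine Eventually.of_forall fun t => ?_
      by_cases ht : t ∈ D R
      · have htW : StrictAnti (ex t) := ht.1
        have h1 := (hball R (by linarith) t ht.1).2 ht.2
        have h2 : Real.log A ≤ R * (2 - ex t 0) := by
          rw [← Real.log_exp (R * (2 - ex t 0))]; exact Real.log_le_log hA h1
        have h3 : ex t 0 ≤ 2 + |Real.log A| := by
          by_contra hc
          push Not at hc
          have := neg_abs_le (Real.log A)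
          nlinarith [abs_nonneg (Real.log A)]
        have hc : t ∈ cube d (2 + |Real.log A|) := by
          intro i
          have e0 : 0 ≤ ex t i := by
            have := htW.antitone (Fin.le_last i); rwa [ex_last] at this
          rw [abs_of_nonneg e0]
          exact (htW.antitone (Fin.zero_le i)).trans h3
        rw [Set.indicator_of_mem ht, Set.indicator_of_mem hc]
        exact ENNReal.div_le_div_left (measure_mono (hrsub R (by linarith) t htW)) ω
      · rw [Set.indicator_of_notMem ht]; exact zero_le
    · rw [lintegral_indicator (measurableSet_cube d _), setLIntegral_const]
      refine ENNReal.mul_ne_top (ENNReal.div_ne_top hωt ?_) (volume_cube_lt_top d _)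
      exact (measure_ball_pos volume _ hr).ne'
    · have hne : ∀ᵐ t : Euc d, ex t 0 ≠ 2 := by
        have h0 : (0 : Fin (d + 1)) ≠ Fin.last d := by
          intro h; have := congrArg Fin.val h; simp at this; omega
        have h1 := measure_hyperplane _ (exL_sub_ne h0) 2
        rw [ae_iff]
        convert h1 using 2
        ext t
        simp [exL]
      filter_upwards [hne] with t ht2
      by_cases htW : t ∈ Wd d
      · have hlim : Tendsto (fun R => ω / volume (Bt δ R t)) atTop (𝓝 (ω / volume (Nb d))) :=
          ENNReal.Tendsto.const_div (h.tendsto_volume htW) (Or.inr hωt)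
        rcases lt_or_gt_of_ne ht2 with hlt | hgt
        · rw [Set.indicator_of_mem (show t ∈ Wd d ∩ {t : Euc d | ex t 0 < 2} from ⟨htW, hlt⟩)]
          refine hlim.congr' ?_
          have hbig : Tendsto (fun R : ℝ => Real.exp (R * (2 - ex t 0))) atTop atTop :=
            Real.tendsto_exp_atTop.comp (tendsto_id.atTop_mul_const (by linarith))
          filter_upwards [hbig.eventually_ge_atTop A', eventually_ge_atTop 0] with R hR hR0
          rw [Set.indicator_of_mem]
          exact ⟨htW, (hball R hR0 t htW).1 hR⟩
        · rw [Set.indicator_of_notMem (show t ∉ Wd d ∩ {t : Euc d | ex t 0 < 2} from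
            fun hh => absurd hh.2 (not_lt.2 hgt.le))]
          refine tendsto_const_nhds.congr' ?_
          have hsmall : Tendsto (fun R : ℝ => Real.exp (R * (2 - ex t 0))) atTop (𝓝 0) :=
            Real.tendsto_exp_atBot.comp (tendsto_id.atTop_mul_const_of_neg (by linarith))
          filter_upwards [hsmall.eventually_lt_const hA, eventually_ge_atTop 0] with R hR hR0
          rw [Set.indicator_of_notMem]
          exact fun hh => absurd ((hball R hR0 t htW).2 hh.2) (not_le.2 hR)
      · rw [Set.indicator_of_notMem (fun hh => htW hh.1)]
        refine tendsto_const_nhds.congr fun R => ?_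
        rw [Set.indicator_of_notMem (fun hh => htW hh.1)]
  refine hmain.congr' ?_
  filter_upwards [eventually_gt_atTop 0] with R hR
  rw [H.lintegral_flag h hR (H.measurableSet_hilbertBall hp R) ω, lintegral_indicator (hDm R)]
  have hR0 : ENNReal.ofReal (R ^ d) ≠ 0 := by
    have : 0 < R ^ d := by positivity
    simpa using this
  rw [mul_comm, ENNReal.mul_div_cancel_right hR0 ENNReal.ofReal_ne_top]

end HRep

/-! ### Assembly -/

namespace HRep

variable {d : ℕ} {ι : Type} {P : Set (Euc d)}

theorem exists_flagData (H : HRep ι P) [Fintype ι] [Nonempty ι] {p : Euc d} (hp : p ∈ interior P)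
    {A : Fin (d + 1) → Finset ι} (hA : A ∈ H.Chains) :
    ∃ k, FlagData (fun j i => H.l j (H.c (A i))) k := by
  obtain ⟨k, hs, hk⟩ := exists_index A hA.1 (H.chain_zero hp hA) (H.isF_ne_univ hp (hA.2 _))
  refine ⟨k, hs, fun j i hi => H.l_c_eq_zero (hA.2 i) ((hk j i).2 hi), fun j i hi => ?_⟩
  exact H.l_c_pos (hA.2 i) (fun hj => absurd ((hk j i).1 hj) (not_lt.2 hi))

theorem sum_pair (H : HRep ι P) [Fintype ι] {m : ℕ} (A : Fin m → Finset ι) (lam : Fin m → ℝ) :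
    ∑ i, lam i • ((H.c (A i), 1) : Euc d × ℝ) = (∑ i, lam i • H.c (A i), ∑ i, lam i) := by
  ext1
  · simp [Prod.fst_sum]
  · simp [Prod.snd_sum]

theorem Sx_disjoint (H : HRep ι P) [Fintype ι] {A B : Fin (d + 1) → Finset ι}
    (hA : A ∈ H.Chains) (hB : B ∈ H.Chains) (hAB : A ≠ B) :
    Disjoint (Sx fun i => H.c (A i)) (Sx fun i => H.c (B i)) := by
  rw [Set.disjoint_left]
  rintro x ⟨μ, hμ, hμs, hμx⟩ ⟨ν, hν, hνs, hνx⟩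
  refine hAB (H.chain_unique d A B hA.1 hB.1 hA.2 hB.2 μ ν hμ hν ?_)
  rw [sum_pair, sum_pair, hμs, hνs, ← hμx, ← hνx]

/-- The exceptional null set. -/
def Nul (H : HRep ι P) [Fintype ι] : Set (Euc d) :=
  ⋃ 𝒞 : {𝒞 : Finset (Finset ι) // 𝒞.Nonempty ∧ 𝒞.card ≤ d},
    (affineSpan ℝ (H.c '' (𝒞.1 : Set (Finset ι))) : Set (Euc d))

theorem volume_Nul (H : HRep ι P) [Fintype ι] : volume H.Nul = 0 := by
  rw [Nul, measure_iUnion_null_iff]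
  rintro ⟨𝒞, hne, hcard⟩
  apply Measure.addHaar_affineSubspace
  intro htop
  have hpos := hne.card_pos
  have h1 := finrank_vectorSpan_image_finset_le ℝ H.c 𝒞 (n := 𝒞.card - 1) (by omega)
  have h2 := congrArg AffineSubspace.direction htop
  rw [direction_affineSpan, AffineSubspace.direction_top] at h2
  rw [Finset.coe_image, h2, finrank_top] at h1
  simp at h1
  omega

theorem int_cover (H : HRep ι P) [Fintype ι] [Nonempty ι] {x : Euc d} (hx : x ∈ interior P) (hn : x ∉ H.Nul) :
    ∃ A ∈ H.Chains, x ∈ Sx fun i => H.c (A i) := by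
  have hX : ∀ j, 0 ≤ H.L j (x, 1) := fun j => by
    rw [L_one]; exact ((H.int' x).1 hx j).le
  obtain ⟨m, A, hA, hAF, -, lam, hlam, hsum⟩ := H.cover hx _ (x, 1) hX
    (by intro h; have := congrArg Prod.snd h; simp at this) rfl
  rw [sum_pair] at hsum
  have hx1 := congrArg Prod.fst hsum
  have hs1 := congrArg Prod.snd hsum
  simp only at hx1 hs1
  have hm : m ≤ d := by
    have hanti : Antitone (fun i : Fin (m + 1) => faceDim (H.Face (A i)) + (i : ℕ)) := by
      rw [Fin.antitone_iff_succ_le]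
      intro i
      have := H.dim_lt (hAF _) (hAF _) (hA (Fin.castSucc_lt_succ (i := i)))
      simp only [Fin.val_succ, Fin.val_castSucc]
      omega
    have h1 := hanti (Fin.zero_le (Fin.last m))
    have h2 := faceDim_le (H.Face (A 0))
    simp only [Fin.val_last, Fin.val_zero] at h1
    omega
  rcases hm.lt_or_eq with hlt | rfl
  · exfalso
    apply hn
    rw [Nul, Set.mem_iUnion]
    refine ⟨⟨Finset.univ.image A, ⟨A 0, by simp⟩, Finset.card_image_le.trans ?_⟩, ?_⟩
    · simp; omega
    · apply convexHull_subset_affineSpan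
      rw [hx1]
      refine (convex_convexHull ℝ _).sum_mem (fun i _ => (hlam i).le) hs1.symm (fun i _ => ?_)
      exact subset_convexHull ℝ _ ⟨A i, by simp, rfl⟩
  · exact ⟨A, ⟨hA, hAF⟩, lam, hlam, hs1.symm, hx1⟩

theorem tendsto_vol (H : HRep ι P) [Fintype ι] (hd : 0 < d) {p : Euc d} (hp : p ∈ interior P) :
    Tendsto (fun R : ℝ => busemannVol (interior P) (hilbertBall (interior P) p R) /
      ENNReal.ofReal (R ^ d)) atTop (𝓝 (((flagSet d P).ncard : ℝ≥0∞) * limC d)) := by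
  have := H.nonempty_index hd (interior_subset hp)
  have hfin : H.Chains.Finite := Set.toFinite _
  set C := hfin.toFinset with hC
  have hmem : ∀ A, A ∈ C ↔ A ∈ H.Chains := fun A => by simp [hC]
  have hlim : Tendsto (fun R : ℝ => ∑ A ∈ C,
      (∫⁻ x in (Sx fun i => H.c (A i)) ∩ hilbertBall (interior P) p R,
        volume (ball (0 : Euc d) 1) / volume (finslerUnitBall (interior P) x)) /
          ENNReal.ofReal (R ^ d)) atTop (𝓝 (∑ A ∈ C, limC d)) := by
    refine tendsto_finsetSum _ fun A hA => ?_
    obtain ⟨k, hk⟩ := H.exists_flagData hp ((hmem A).1 hA)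
    exact H.tendsto_flag hd hk hp
  rw [Finset.sum_const, nsmul_eq_mul, hC, ← Set.ncard_eq_toFinset_card _ hfin,
    ← H.ncard_flagSet] at hlim
  refine hlim.congr fun R => ?_
  simp only [div_eq_mul_inv _ (ENNReal.ofReal (R ^ d))]
  rw [← Finset.sum_mul]
  congr 1
  have hBm := H.measurableSet_hilbertBall hp R
  rw [← lintegral_biUnion_finset, busemannVol]
  · refine setLIntegral_congr ?_
    rw [eventuallyEq_set]
    have hnul : ∀ᵐ x, x ∉ H.Nul := measure_eq_zero_iff_ae_notMem.1 H.volume_Nul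
    filter_upwards [hnul] with x hx
    simp only [Set.mem_iUnion, Set.mem_inter_iff]
    constructor
    · rintro ⟨A, -, -, h⟩; exact h
    · intro h
      obtain ⟨A, hA, hxA⟩ := H.int_cover h.1 hx
      exact ⟨A, (hmem A).2 hA, hxA, h⟩
  · intro A hA B hB hAB
    exact (H.Sx_disjoint ((hmem A).1 hA) ((hmem B).1 hB) hAB).mono Set.inter_subset_left
      Set.inter_subset_left
  · intro A hA
    obtain ⟨k, hk⟩ := H.exists_flagData hp ((hmem A).1 hA)
    exact (measurableSet_Sx _ H hk).inter hBm

end HRep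

/-- The asymptotic volume of a `d`-dimensional polytope `P ⊆ ℝ^d` equals
`|Flags(P)| / (d+1)!` times the asymptotic volume of any `d`-simplex `Σ ⊆ ℝ^d`. -/
theorem asympVol_polytope (d : ℕ) (V : Finset (Euc d)) (hV : V.Nonempty)
    (P : Set (Euc d)) (hP : P = convexHull ℝ (V : Set (Euc d))) (hdim : faceDim P = d)
    (Sig : Set (Euc d)) (hSig : IsSimplexSet d Sig)
    (p : Euc d) (hp : p ∈ interior P) (q : Euc d) (hq : q ∈ interior Sig) :
    liminf (fun R : ℝ =>
        busemannVol (interior P) (hilbertBall (interior P) p R) / ENNReal.ofReal (R ^ d))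
      atTop
    = (((flagSet d P).ncard : ℝ≥0∞) / ((Nat.factorial (d + 1) : ℕ) : ℝ≥0∞)) *
      liminf (fun R : ℝ =>
          busemannVol (interior Sig) (hilbertBall (interior Sig) q R) / ENNReal.ofReal (R ^ d))
        atTop := by
  obtain ⟨v, hv, rfl⟩ := hSig
  have htop : affineSpan ℝ (Set.range v) = ⊤ :=
    hv.affineSpan_eq_top_iff_card_eq_finrank_add_one.2 (by simp)
  let B : AffineBasis (Fin (d + 1)) ℝ (Euc d) := ⟨v, hv, htop⟩
  have hcard : (flagSet d (convexHull ℝ (Set.range v))).ncard = (d + 1).factorial :=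
    simplex_ncard B
  have hf0 : ((Nat.factorial (d + 1) : ℕ) : ℝ≥0∞) ≠ 0 := by
    exact_mod_cast (Nat.factorial_pos (d + 1)).ne'
  have hft : ((Nat.factorial (d + 1) : ℕ) : ℝ≥0∞) ≠ ⊤ := ENNReal.natCast_ne_top _
  rcases Nat.eq_zero_or_pos d with rfl | hd
  · have hPS : P = convexHull ℝ (Set.range v) := by
      ext x
      rw [Subsingleton.elim x p]
      refine ⟨fun _ => ?_, fun _ => interior_subset hp⟩
      rw [Subsingleton.elim p q]; exact interior_subset hq
    subst hPS
    rw [Subsingleton.elim p q, hcard, ENNReal.div_self hf0 hft, one_mul]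
  · subst hP
    obtain ⟨ι, hι, ⟨H⟩⟩ := exists_hrep V
    have HS : HRep (Fin (d + 1)) (convexHull ℝ (Set.range v)) := simplexHRep B
    rw [(H.tendsto_vol hd hp).liminf_eq, (HS.tendsto_vol hd hq).liminf_eq]
    rw [hcard, ← mul_assoc, ENNReal.div_mul_cancel hf0 hft]


end
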